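/- Let K = SO(p) × SO(q) with p ≥ q + 2 ≥ 7, and let H = SO(p−q) × {1} ⊂ K, where SO(p−q) ⊂ SO(p) acts on the last p−q coordinates of ℝ^p. If G is a closed connected subgroup of K such that G × H acts on K with cohomogeneity at most one by left and right translations, then G = K. -/

import Mathlib

/-! Statement 12: if `K = SO p × SO q` (`p ≥ q + 2 ≥ 7`), `H = SO(p-q) × {1}` acting on
the last `p-q` coordinates of `ℝ^p`, and `G` is a closed connected subgroup of `K` such
that `G × H` acts on `K` with cohomogeneity at most one by left and right translations,
then `G = K`. -/
open Module

noncomputable section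

/-- The tangent space at `x` of a set `S` of matrices: the span of all entrywise
velocities at `0` of curves in `S` passing through `x`. -/
def matTangentAt {m n R : Type*} [NormedAddCommGroup R] [NormedSpace ℝ R]
    (S : Set (Matrix m n R)) (x : Matrix m n R) : Submodule ℝ (Matrix m n R) :=
  Submodule.span ℝ {w | ∃ c : ℝ → Matrix m n R, (∀ t, c t ∈ S) ∧ c 0 = x ∧
    ∀ i j, HasDerivAt (fun t => c t i j) (w i j) 0}

variable {n : Type*} {R : Type*} [Fintype n] [DecidableEq n] [Semiring R] [StarRing R]

/-- A set of square matrices is a subgroup (of a unitary group) if it contains `1` and is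
closed under multiplication and conjugate transposition (= inversion, for unitary
matrices). -/
def IsMatSubgroup (G : Set (Matrix n n R)) : Prop :=
  (1 : Matrix n n R) ∈ G ∧ (∀ a ∈ G, ∀ b ∈ G, a * b ∈ G) ∧ ∀ a ∈ G, star a ∈ G

/-- The orbit of `k` under the action of `G × H` by left and right translations,
`(g, h) · k = g * k * h⁻¹` (for unitary matrices `h⁻¹ = star h`). -/
def lrOrbit (G H : Set (Matrix n n R)) (k : Matrix n n R) : Set (Matrix n n R) :=
  {x | ∃ g ∈ G, ∃ h ∈ H, x = g * k * star h}

/-- The dimension of a matrix group: the dimension of its tangent space at `1`. -/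
def grpDim [NormedAddCommGroup R] [NormedSpace ℝ R] (K : Set (Matrix n n R)) : ℕ :=
  finrank ℝ (matTangentAt K 1)

/-- The cohomogeneity of the action of `G × H` on `K` by left and right translations:
`dim K` minus the maximal orbit dimension. -/
def lrCohomogeneity [NormedAddCommGroup R] [NormedSpace ℝ R]
    (G H K : Set (Matrix n n R)) : ℕ :=
  grpDim K - ⨆ k : K, finrank ℝ (matTangentAt (lrOrbit G H k) (k : Matrix n n R))

end

noncomputable section

/-- The group `SO p × SO q`, realized as block-diagonal real orthogonal matrices
indexed by `Fin p ⊕ Fin q`, each block of determinant one. -/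
def SOPairSet (p q : ℕ) : Set (Matrix (Fin p ⊕ Fin q) (Fin p ⊕ Fin q) ℝ) :=
  {A | star A * A = 1 ∧ A * star A = 1 ∧
    (∀ (i : Fin p) (j : Fin q), A (Sum.inl i) (Sum.inr j) = 0 ∧ A (Sum.inr j) (Sum.inl i) = 0) ∧
    (Matrix.toBlocks₁₁ A).det = 1 ∧ (Matrix.toBlocks₂₂ A).det = 1}

/-- The subgroup `SO(p-q) × {1} ⊆ SO p × SO q`, where `SO(p-q)` acts on the last `p-q`
coordinates of `ℝ^p`. -/
def SOPrincipalIsotropy (p q : ℕ) : Set (Matrix (Fin p ⊕ Fin q) (Fin p ⊕ Fin q) ℝ) :=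
  {A | A ∈ SOPairSet p q ∧
    -- the first `q` coordinates of `ℝ^p` are fixed
    (∀ i : Fin p, (i : ℕ) < q → ∀ j, A (Sum.inl i) j = if j = Sum.inl i then 1 else 0) ∧
    -- the last `p - q` rows are supported on the last `p - q` columns
    (∀ i : Fin p, q ≤ (i : ℕ) → ∀ j : Fin p, (j : ℕ) < q → A (Sum.inl i) (Sum.inl j) = 0) ∧
    -- the `SO q`-factor is trivial
    ∀ i : Fin q, ∀ j, A (Sum.inr i) j = if j = Sum.inr i then 1 else 0}

end

section

open Matrix

/-- The space of skew-symmetric real matrices. -/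
def skewMat (ι : Type*) : Submodule ℝ (Matrix ι ι ℝ) where
  carrier := {A | Aᵀ = -A}
  add_mem' {a b} ha hb := by
    simp only [Set.mem_ofPred_eq] at *
    rw [transpose_add, ha, hb]; abel
  zero_mem' := by simp
  smul_mem' c a ha := by
    simp only [Set.mem_ofPred_eq] at *
    rw [transpose_smul, ha, smul_neg]

section SkewAlgebra

variable {ι : Type*}

theorem mem_skewMat {A : Matrix ι ι ℝ} : A ∈ skewMat ι ↔ Aᵀ = -A := Iff.rfl

theorem skewMat_apply {A : Matrix ι ι ℝ} (hA : A ∈ skewMat ι) (i j : ι) : A j i = -A i j :=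
  congrFun (congrFun hA i) j

theorem skewMat_diag {A : Matrix ι ι ℝ} (hA : A ∈ skewMat ι) (i : ι) : A i i = 0 := by
  have := skewMat_apply hA i i
  linarith

section

variable [DecidableEq ι]

/-- The elementary skew-symmetric matrices. -/
def skewUnit (i j : ι) : Matrix ι ι ℝ := single i j 1 - single j i 1

theorem skewUnit_mem (i j : ι) : skewUnit i j ∈ skewMat ι := by
  rw [mem_skewMat]
  simp [skewUnit]

theorem skewUnit_swap (i j : ι) : skewUnit j i = -skewUnit i j := by
  simp [skewUnit]

theorem skewUnit_self (i : ι) : skewUnit i i = 0 := by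
  simp [skewUnit]

theorem skewUnit_apply (i j k l : ι) : skewUnit i j k l =
    (if i = k ∧ j = l then 1 else 0) - (if j = k ∧ i = l then 1 else 0) := by
  simp [skewUnit, single_apply]

end

variable [Fintype ι]

/-- The trace form `tr (Aᵀ B)` on real matrices. -/
noncomputable def frob (ι : Type*) [Fintype ι] : LinearMap.BilinForm ℝ (Matrix ι ι ℝ) :=
  LinearMap.mk₂ ℝ (fun A B => (Aᵀ * B).trace)
    (by intro a b c; simp [add_mul]) (by intro a b c; simp)
    (by intro a b c; simp [mul_add]) (by intro a b c; simp)

theorem frob_apply (A B : Matrix ι ι ℝ) : frob ι A B = (Aᵀ * B).trace := rfl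

theorem frob_comm (A B : Matrix ι ι ℝ) : frob ι A B = frob ι B A := by
  rw [frob_apply, frob_apply, ← trace_transpose, transpose_mul, transpose_transpose]

theorem frob_eq_sum (A B : Matrix ι ι ℝ) : frob ι A B = ∑ i, ∑ j, A j i * B j i := by
  simp [frob_apply, trace, mul_apply]

theorem frob_self_eq_zero {A : Matrix ι ι ℝ} (h : frob ι A A = 0) : A = 0 :=
  trace_conjTranspose_mul_self_eq_zero_iff.mp (by simpa [frob_apply] using h)

theorem isCompl_frob_orthogonal (S : Submodule ℝ (Matrix ι ι ℝ)) :
    IsCompl S ((frob ι).orthogonal S) := by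
  apply LinearMap.BilinForm.isCompl_orthogonal_of_restrict_nondegenerate
  · exact (LinearMap.BilinForm.IsSymm.mk fun A B => frob_comm A B).isRefl
  · constructor
    · intro x hx
      exact Subtype.ext (frob_self_eq_zero (hx x))
    · intro x hx
      exact Subtype.ext (frob_self_eq_zero (hx x))

theorem mem_of_forall_frob_eq_zero {S T : Submodule ℝ (Matrix ι ι ℝ)} (hST : S ≤ T)
    {Z : Matrix ι ι ℝ} (hZ : Z ∈ T)
    (h : ∀ Y ∈ T, (∀ X ∈ S, frob ι X Y = 0) → frob ι Z Y = 0) : Z ∈ S := by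
  have hc := isCompl_frob_orthogonal S
  obtain ⟨a, ha, t, ht, rfl⟩ := Submodule.mem_sup.mp (hc.sup_eq_top ▸ Submodule.mem_top (x := Z))
  have htT : t ∈ T := by simpa using T.sub_mem hZ (hST ha)
  have h1 := h t htT ht
  have h2 : frob ι a t = 0 := ht a ha
  rw [map_add, LinearMap.add_apply, h2, zero_add] at h1
  rw [frob_self_eq_zero h1, add_zero]
  exact ha

variable [DecidableEq ι]

theorem frob_lie {X : Matrix ι ι ℝ} (hX : X ∈ skewMat ι) (A B : Matrix ι ι ℝ) :
    frob ι ⁅X, A⁆ B = -frob ι A ⁅X, B⁆ := by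
  rw [mem_skewMat] at hX
  simp only [frob_apply, LieRing.of_associative_ring_bracket, transpose_sub, transpose_mul, hX,
    sub_mul, mul_sub, trace_sub, neg_mul, mul_neg, trace_neg, Matrix.mul_assoc]
  rw [trace_mul_comm X, Matrix.mul_assoc]
  ring

theorem lie_mem_skewMat {A B : Matrix ι ι ℝ} (hA : A ∈ skewMat ι) (hB : B ∈ skewMat ι) :
    ⁅A, B⁆ ∈ skewMat ι := by
  rw [mem_skewMat] at *
  simp [LieRing.of_associative_ring_bracket, hA, hB]

theorem frob_skewUnit (i j : ι) (A : Matrix ι ι ℝ) :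
    frob ι (skewUnit i j) A = A i j - A j i := by
  simp [frob_apply, skewUnit, trace_single_mul]

theorem frob_skewUnit_of_mem (i j : ι) {A : Matrix ι ι ℝ} (hA : A ∈ skewMat ι) :
    frob ι (skewUnit i j) A = 2 * A i j := by
  rw [frob_skewUnit, skewMat_apply hA i j]; ring

theorem lie_skewUnit_apply (a b : ι) (Y : Matrix ι ι ℝ) (i j : ι) :
    ⁅skewUnit a b, Y⁆ i j = (if i = a then Y b j else 0) - (if i = b then Y a j else 0)
      - (if j = b then Y i a else 0) + (if j = a then Y i b else 0) := by
  simp only [LieRing.of_associative_ring_bracket, skewUnit, sub_mul, mul_sub, Matrix.sub_apply]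
  have h1 : ∀ a b : ι, (single a b (1:ℝ) * Y) i j = if i = a then Y b j else 0 := by
    intro a b
    split_ifs with h
    · subst h; simp
    · simp [h]
  have h2 : ∀ a b : ι, (Y * single a b (1:ℝ)) i j = if j = b then Y i a else 0 := by
    intro a b
    split_ifs with h
    · subst h; simp
    · simp [h]
  rw [h1, h1, h2, h2]; ring

theorem lie_skewUnit_skewUnit {x y z : ι} (hxy : x ≠ y) (hz : z ≠ x) (hz' : z ≠ y) :
    ⁅skewUnit x y, skewUnit y z⁆ = skewUnit x z := by
  simp [LieRing.of_associative_ring_bracket, skewUnit, sub_mul, mul_sub, hxy, hxy.symm, hz,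
    hz.symm, hz', hz'.symm]

theorem lie_skewUnit_skewUnit' {x y z : ι} (hxy : x ≠ y) (hz : z ≠ x) (hz' : z ≠ y) :
    ⁅skewUnit x y, skewUnit x z⁆ = -skewUnit y z := by
  rw [← lie_skewUnit_skewUnit hxy.symm hz' hz, skewUnit_swap y x]
  simp only [LieRing.of_associative_ring_bracket, Matrix.neg_mul, Matrix.mul_neg]
  abel

theorem lie_skewUnit_eq_zero {x y z w : ι} (h1 : z ≠ x) (h2 : z ≠ y) (h3 : w ≠ x) (h4 : w ≠ y) :
    ⁅skewUnit x y, skewUnit z w⁆ = 0 := by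
  simp [LieRing.of_associative_ring_bracket, skewUnit, sub_mul, mul_sub, h1, h1.symm, h2, h2.symm,
    h3, h3.symm, h4, h4.symm]

theorem eq_sum_skewUnit {A : Matrix ι ι ℝ} (hA : A ∈ skewMat ι) :
    A = ∑ i, ∑ j, (A i j / 2) • skewUnit i j := by
  have h1 : ∑ i, ∑ j, (A i j / 2) • (single i j (1:ℝ)) = (1/2 : ℝ) • A := by
    conv_rhs => rw [matrix_eq_sum_single A]
    simp only [Finset.smul_sum]
    refine Finset.sum_congr rfl fun i _ => Finset.sum_congr rfl fun j _ => ?_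
    simp; ring_nf
  have h2 : ∑ i, ∑ j, (A i j / 2) • (single j i (1:ℝ)) = -((1/2 : ℝ) • A) := by
    rw [← h1, Finset.sum_comm, ← Finset.sum_neg_distrib]
    refine Finset.sum_congr rfl fun i _ => ?_
    rw [← Finset.sum_neg_distrib]
    refine Finset.sum_congr rfl fun j _ => ?_
    rw [skewMat_apply hA i j, neg_div, neg_smul]
  simp only [skewUnit, smul_sub, Finset.sum_sub_distrib]
  rw [h1, h2, sub_neg_eq_add, ← add_smul]
  norm_num

theorem skewMat_le_of_skewUnit_mem {S : Submodule ℝ (Matrix ι ι ℝ)}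
    (h : ∀ i j, skewUnit i j ∈ S) : skewMat ι ≤ S := by
  intro A hA
  rw [eq_sum_skewUnit hA]
  exact S.sum_mem fun i _ => S.sum_mem fun j _ => S.smul_mem _ (h i j)

end SkewAlgebra

end

section

open Matrix

section Ideals

variable {ι : Type*} [Fintype ι] [DecidableEq ι]

theorem skewMat_le_of_ideal_of_skewUnit_mem {I : Submodule ℝ (Matrix ι ι ℝ)}
    (hI : ∀ Z ∈ skewMat ι, ∀ A ∈ I, ⁅Z, A⁆ ∈ I) {e f : ι} (hef : e ≠ f)
    (h : skewUnit e f ∈ I) : skewMat ι ≤ I := by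
  have hswap : ∀ x y : ι, skewUnit x y ∈ I → skewUnit y x ∈ I := by
    intro x y hxy
    rw [skewUnit_swap]
    exact I.neg_mem hxy
  have hrep : ∀ x y z : ι, y ≠ z → skewUnit y z ∈ I → skewUnit x z ∈ I := by
    intro x y z hne hyz
    by_cases hxy : x = y
    · rwa [hxy]
    by_cases hzx : z = x
    · subst hzx; rw [skewUnit_self]; exact I.zero_mem
    rw [← lie_skewUnit_skewUnit hxy hzx hne.symm]
    exact hI _ (skewUnit_mem _ _) _ hyz
  refine skewMat_le_of_skewUnit_mem fun i j => ?_
  by_cases hif : i = f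
  · subst hif
    exact hswap _ _ (hrep j e i hef h)
  · exact hswap _ _ (hrep j f i (Ne.symm hif) (hswap _ _ (hrep i e f hef h)))

theorem skewMat_le_of_ideal {I : Submodule ℝ (Matrix ι ι ℝ)} (hle : I ≤ skewMat ι)
    (hI : ∀ Z ∈ skewMat ι, ∀ A ∈ I, ⁅Z, A⁆ ∈ I) (hcard : 6 ≤ Fintype.card ι)
    {Y : Matrix ι ι ℝ} (hY : Y ∈ I) (hY0 : Y ≠ 0) : skewMat ι ≤ I := by
  obtain ⟨b, d, hbd⟩ : ∃ b d, Y b d ≠ 0 := by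
    by_contra! h
    exact hY0 (by ext i j; exact h i j)
  have hYs := hle hY
  have hne : b ≠ d := by
    rintro rfl
    exact hbd (skewMat_diag hYs b)
  have hex : ∀ s : Finset ι, s.card < 6 → ∃ x, x ∉ s := by
    intro s hs
    by_contra! h
    have : s = Finset.univ := Finset.eq_univ_iff_forall.mpr h
    rw [this, Finset.card_univ] at hs
    omega
  obtain ⟨a, ha⟩ := hex {b, d} (lt_of_le_of_lt (Finset.card_le_two) (by norm_num))
  obtain ⟨c, hc⟩ := hex {a, b, d} (lt_of_le_of_lt (Finset.card_le_three) (by norm_num))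
  obtain ⟨e, he⟩ := hex {a, b, c, d} (lt_of_le_of_lt (Finset.card_le_four) (by norm_num))
  obtain ⟨f, hf⟩ := hex {a, b, c, d, e} (lt_of_le_of_lt (Finset.card_le_five) (by norm_num))
  simp only [Finset.mem_insert, Finset.mem_singleton, not_or] at ha hc he hf
  obtain ⟨hab, had⟩ := ha
  obtain ⟨hca, hcb, hcd⟩ := hc
  obtain ⟨hea, heb, hec, hed⟩ := he
  obtain ⟨hfa, hfb, hfc, hfd, hfe⟩ := hf
  set R : Matrix ι ι ℝ := ⁅skewUnit c d, ⁅skewUnit a b, Y⁆⁆ with hR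
  have hRm : R ∈ I := hI _ (skewUnit_mem _ _) _ (hI _ (skewUnit_mem _ _) _ hY)
  have hRs := hle hRm
  have hRac : R a c = Y b d := by
    simp [hR, lie_skewUnit_apply, Ne.symm hca, hcd, had, hab, hne.symm, Ne.symm had]
  have hR1 : ∀ i j, i ≠ c → i ≠ d → j ≠ c → j ≠ d → R i j = 0 := by
    intro i j h1 h2 h3 h4
    simp [hR, lie_skewUnit_apply, h1, h2, h3, h4]
  have hR2 : ∀ i j, i ≠ a → i ≠ b → j ≠ a → j ≠ b → R i j = 0 := by
    intro i j h1 h2 h3 h4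
    simp [hR, lie_skewUnit_apply, h1, h2, h3, h4, hne.symm, Ne.symm had, hca, hcb]
  set Q : Matrix ι ι ℝ := ⁅skewUnit f a, R⁆ with hQ
  have hQm : Q ∈ I := hI _ (skewUnit_mem _ _) _ hRm
  have hQs := hle hQm
  have hQe : ∀ j, Q e j = 0 := by
    intro j
    simp [hQ, lie_skewUnit_apply, hea, Ne.symm hfe, hR1 e a hec hed (Ne.symm hca) had,
      hR1 e f hec hed hfc hfd]
  have hQc : ∀ j, Q c j = if j = f then - Y b d else 0 := by
    intro j
    simp [hQ, lie_skewUnit_apply, hca, Ne.symm hfc, hR2 c f hca hcb hfa hfb,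
      skewMat_apply hRs a c, hRac]
  have hS : ⁅skewUnit e c, Q⁆ = (- Y b d) • skewUnit e f := by
    ext i j
    simp only [lie_skewUnit_apply, Matrix.smul_apply, skewUnit_apply, smul_eq_mul, hQe,
      skewMat_apply hQs e, skewMat_apply hQs c, hQc]
    by_cases h1 : i = e <;> by_cases h2 : j = f <;> by_cases h3 : j = e <;>
      by_cases h4 : i = f <;> simp_all [eq_comm]
  have hef : skewUnit e f ∈ I := by
    have h := hI _ (skewUnit_mem e c) _ hQm
    rw [hS] at h
    exact (I.smul_mem_iff (neg_ne_zero.mpr hbd)).mp h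
  exact skewMat_le_of_ideal_of_skewUnit_mem hI (Ne.symm hfe) hef

end Ideals

end

section

open Matrix

section Generation

open scoped TensorProduct

theorem foldr_apply_add {L M : Type*} [AddCommGroup M] [Module ℝ M] (D : L → Module.End ℝ M)
    (l : List L) (m m' : M) : l.foldr (fun z m => D z m) (m + m')
      = l.foldr (fun z m => D z m) m + l.foldr (fun z m => D z m) m' := by
  induction l with
  | nil => rfl
  | cons z a ih => simp only [List.foldr_cons, ih, map_add]

theorem foldr_apply_smul {L M : Type*} [AddCommGroup M] [Module ℝ M] (D : L → Module.End ℝ M)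
    (l : List L) (c : ℝ) (m : M) : l.foldr (fun z m => D z m) (c • m)
      = c • l.foldr (fun z m => D z m) m := by
  induction l with
  | nil => rfl
  | cons z a ih => simp only [List.foldr_cons, ih, map_smul]

/-- If a functional `β` on a representation `D` is invariant under `g`, and the action of `k` on
`v` agrees with that of `g`, then `β` kills every nontrivial product of elements of `k` applied
to `v`. -/
theorem functional_foldr_eq_zero {L M : Type*} [AddCommGroup M] [Module ℝ M]
    (D : L → Module.End ℝ M) {g k : Set L}
    (hD : ∀ z ∈ k, ∀ x ∈ g, ∃ y ∈ k, ∀ m, D z (D x m) = D y m + D x (D z m))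
    (β : M →ₗ[ℝ] ℝ) (hβ : ∀ x ∈ g, ∀ m, β (D x m) = 0)
    {v : M} (hv : ∀ z ∈ k, ∃ x ∈ g, D z v = D x v) (n : ℕ) :
    ∀ l : List L, l.length = n + 1 → (∀ z ∈ l, z ∈ k) →
      β (l.foldr (fun z m => D z m) v) = 0 := by
  induction n with
  | zero =>
    intro l hl hlk
    obtain ⟨z, rfl⟩ := List.length_eq_one_iff.mp hl
    obtain ⟨x, hx, hzx⟩ := hv z (hlk z (by simp))
    simp only [List.foldr_cons, List.foldr_nil, hzx]
    exact hβ x hx v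
  | succ n ih =>
    have key : ∀ x ∈ g, ∀ a b : List L, a.length + b.length = n + 1 → (∀ z ∈ a, z ∈ k) →
        (∀ z ∈ b, z ∈ k) →
        β (a.foldr (fun z m => D z m) (D x (b.foldr (fun z m => D z m) v))) = 0 := by
      intro x hx a
      induction a using List.reverseRecOn with
      | nil => intro b _ _ _; exact hβ x hx _
      | append_singleton a z iha =>
        intro b hab ha hb
        have hz : z ∈ k := ha z (by simp)
        obtain ⟨y, hy, hyz⟩ := hD z hz x hx
        rw [List.foldr_append, List.foldr_cons, List.foldr_nil, hyz, foldr_apply_add, map_add]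
        have h1 := ih (a ++ y :: b) (by simp at hab ⊢; omega) (by
          intro w hw
          simp only [List.mem_append, List.mem_cons] at hw
          rcases hw with hw | rfl | hw
          · exact ha w (by simp [hw])
          · exact hy
          · exact hb w hw)
        rw [List.foldr_append, List.foldr_cons] at h1
        have h2 := iha (z :: b) (by simp at hab ⊢; omega) (fun y hy => ha y (by simp [hy])) (by
          intro y hy
          rcases List.mem_cons.mp hy with rfl | hy
          · exact hz
          · exact hb y hy)
        rw [List.foldr_cons] at h2
        rw [h1, h2, add_zero]
    intro l hl hlk
    obtain ⟨a, z, rfl⟩ : ∃ a z, l = a ++ [z] := by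
      rcases List.eq_nil_or_concat l with h | h
      · simp [h] at hl
      · simpa using h
    obtain ⟨x, hx, hzx⟩ := hv z (hlk z (by simp))
    rw [List.foldr_append, List.foldr_cons, List.foldr_nil, hzx]
    exact key x hx a [] (by simpa using hl) (fun y hy => hlk y (by simp [hy])) (by simp)

/-- The space of vectors `m` such that `β` kills all nontrivial products of elements of `k`
applied to `m`. -/
def productKilled {L M : Type*} [AddCommGroup M] [Module ℝ M] (D : L → Module.End ℝ M)
    (k : Set L) (β : M →ₗ[ℝ] ℝ) : Submodule ℝ M where
  carrier := {m | ∀ l : List L, l ≠ [] → (∀ z ∈ l, z ∈ k) →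
    β (l.foldr (fun z m => D z m) m) = 0}
  add_mem' {m m'} hm hm' l hl hlk := by
    rw [foldr_apply_add, map_add, hm l hl hlk, hm' l hl hlk, add_zero]
  zero_mem' l hl hlk := by
    rw [← zero_smul ℝ (0 : M), foldr_apply_smul, zero_smul, map_zero]
  smul_mem' c m hm l hl hlk := by
    rw [foldr_apply_smul, map_smul, hm l hl hlk, smul_zero]

theorem apply_mem_productKilled {L M : Type*} [AddCommGroup M] [Module ℝ M]
    {D : L → Module.End ℝ M} {k : Set L} {β : M →ₗ[ℝ] ℝ} {m : M}
    (hm : m ∈ productKilled D k β) {z : L} (hz : z ∈ k) : D z m ∈ productKilled D k β := by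
  intro l hl hlk
  have := hm (l ++ [z]) (by simp) (by
    intro y hy
    rcases List.mem_append.mp hy with hy | hy
    · exact hlk y hy
    · rw [List.mem_singleton.mp hy]; exact hz)
  simpa using this

theorem map_apply_of_mem_productKilled {L M : Type*} [AddCommGroup M] [Module ℝ M]
    {D : L → Module.End ℝ M} {k : Set L} {β : M →ₗ[ℝ] ℝ} {m : M}
    (hm : m ∈ productKilled D k β) {z : L} (hz : z ∈ k) : β (D z m) = 0 := by
  simpa using hm [z] (by simp) (by simpa using hz)

variable {ι : Type*} [Fintype ι] [DecidableEq ι]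

/-- The commutator map `A ↦ ⁅Z, A⁆` on matrices. -/
noncomputable def adMat (Z : Matrix ι ι ℝ) : Matrix ι ι ℝ →ₗ[ℝ] Matrix ι ι ℝ :=
  LinearMap.mulLeft ℝ Z - LinearMap.mulRight ℝ Z

/-- The action of matrices by derivations on the tensor square of the adjoint representation. -/
noncomputable def adTensor (Z : Matrix ι ι ℝ) : Module.End ℝ (Matrix ι ι ℝ ⊗[ℝ] Matrix ι ι ℝ) :=
  TensorProduct.map (adMat Z) LinearMap.id + TensorProduct.map LinearMap.id (adMat Z)

theorem adTensor_tmul (Z A B : Matrix ι ι ℝ) :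
    adTensor Z (A ⊗ₜ[ℝ] B) = ⁅Z, A⁆ ⊗ₜ[ℝ] B + A ⊗ₜ[ℝ] ⁅Z, B⁆ := rfl

theorem lie_lie_mat (Z X A : Matrix ι ι ℝ) : ⁅Z, ⁅X, A⁆⁆ = ⁅⁅Z, X⁆, A⁆ + ⁅X, ⁅Z, A⁆⁆ := by
  simp only [LieRing.of_associative_ring_bracket]
  noncomm_ring

theorem adTensor_adTensor (Z X : Matrix ι ι ℝ) (T : Matrix ι ι ℝ ⊗[ℝ] Matrix ι ι ℝ) :
    adTensor Z (adTensor X T) = adTensor ⁅Z, X⁆ T + adTensor X (adTensor Z T) := by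
  induction T with
  | zero => simp
  | add a b ha hb => simp only [map_add, ha, hb]; abel
  | tmul A B =>
    simp only [adTensor_tmul, map_add, lie_lie_mat Z X A, lie_lie_mat Z X B,
      TensorProduct.add_tmul, TensorProduct.tmul_add]
    abel

theorem skewUnit_tmul_mem_of_replace {N : Submodule ℝ (Matrix ι ι ℝ ⊗[ℝ] Matrix ι ι ℝ)}
    (hN : ∀ Z ∈ skewMat ι, ∀ T ∈ N, adTensor Z T ∈ N) {a b c d x y : ι} (hxy : x ≠ y)
    (ha : y ≠ a) (hb : y ≠ b) (hc : y ≠ c) (hd : y ≠ d)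
    (h : skewUnit (if a = x then y else a) (if b = x then y else b) ⊗ₜ[ℝ]
      skewUnit (if c = x then y else c) (if d = x then y else d) ∈ N) :
    skewUnit a b ⊗ₜ[ℝ] skewUnit c d ∈ N := by
  have one : ∀ {b c d : ι}, y ≠ b → y ≠ c → y ≠ d → b ≠ x → c ≠ x → d ≠ x →
      (skewUnit y b ⊗ₜ[ℝ] skewUnit c d ∈ N → skewUnit x b ⊗ₜ[ℝ] skewUnit c d ∈ N) ∧
      (skewUnit c d ⊗ₜ[ℝ] skewUnit y b ∈ N → skewUnit c d ⊗ₜ[ℝ] skewUnit x b ∈ N) := by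
    intro b c d hb hc hd hb' hc' hd'
    constructor <;> intro h <;> have h' := hN _ (skewUnit_mem x y) _ h
    · rwa [adTensor_tmul, lie_skewUnit_skewUnit hxy hb' hb.symm,
        lie_skewUnit_eq_zero hc' hc.symm hd' hd.symm, TensorProduct.tmul_zero, add_zero] at h'
    · rwa [adTensor_tmul, lie_skewUnit_skewUnit hxy hb' hb.symm,
        lie_skewUnit_eq_zero hc' hc.symm hd' hd.symm, TensorProduct.zero_tmul, zero_add] at h'
  have two : ∀ {b d : ι}, y ≠ b → y ≠ d → b ≠ x → d ≠ x →
      skewUnit y b ⊗ₜ[ℝ] skewUnit y d ∈ N → skewUnit x b ⊗ₜ[ℝ] skewUnit x d ∈ N := by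
    intro b d hb hd hb' hd' h
    have h' := hN _ (skewUnit_mem x y) _ (hN _ (skewUnit_mem x y) _ h)
    simp only [adTensor_tmul, map_add, lie_skewUnit_skewUnit hxy hb' hb.symm,
      lie_skewUnit_skewUnit hxy hd' hd.symm, lie_skewUnit_skewUnit' hxy hb' hb.symm,
      lie_skewUnit_skewUnit' hxy hd' hd.symm, TensorProduct.neg_tmul, TensorProduct.tmul_neg] at h'
    have h2 := N.smul_mem (1/2 : ℝ) (N.add_mem h' (N.smul_mem (2:ℝ) h))
    convert h2 using 1
    module
  have swap1 : ∀ {a b} {A : Matrix ι ι ℝ},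
      skewUnit a b ⊗ₜ[ℝ] A ∈ N → skewUnit b a ⊗ₜ[ℝ] A ∈ N := by
    intro a b A
    rw [skewUnit_swap b a, TensorProduct.neg_tmul, N.neg_mem_iff]
    exact id
  have swap2 : ∀ {a b} {A : Matrix ι ι ℝ},
      A ⊗ₜ[ℝ] skewUnit a b ∈ N → A ⊗ₜ[ℝ] skewUnit b a ∈ N := by
    intro a b A
    rw [skewUnit_swap b a, TensorProduct.tmul_neg, N.neg_mem_iff]
    exact id
  by_cases hab : a = b
  · rw [hab, skewUnit_self, TensorProduct.zero_tmul]; exact N.zero_mem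
  by_cases hcd : c = d
  · rw [hcd, skewUnit_self, TensorProduct.tmul_zero]; exact N.zero_mem
  rcases eq_or_ne a x with rfl | hax
  · rcases eq_or_ne c a with rfl | hcx
    · simp only [Ne.symm hab, Ne.symm hcd, if_true, if_false] at h
      exact two hb hd (Ne.symm hab) (Ne.symm hcd) h
    rcases eq_or_ne d a with rfl | hdx
    · simp only [Ne.symm hab, hcx, if_true, if_false] at h
      exact swap2 (two hb hc (Ne.symm hab) hcx (swap2 h))
    simp only [Ne.symm hab, hcx, hdx, if_true, if_false] at h
    exact (one hb hc hd (Ne.symm hab) hcx hdx).1 h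
  rcases eq_or_ne b x with rfl | hbx
  · rcases eq_or_ne c b with rfl | hcx
    · simp only [hax, Ne.symm hcd, if_true, if_false] at h
      exact swap1 (two ha hd hax (Ne.symm hcd) (swap1 h))
    rcases eq_or_ne d b with rfl | hdx
    · simp only [hax, hcx, if_true, if_false] at h
      exact swap1 (swap2 (two ha hc hax hcx (swap1 (swap2 h))))
    simp only [hax, hcx, hdx, if_true, if_false] at h
    exact swap1 ((one ha hc hd hax hcx hdx).1 (swap1 h))
  rcases eq_or_ne c x with rfl | hcx
  · simp only [hax, hbx, Ne.symm hcd, if_true, if_false] at h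
    exact (one hd ha hb (Ne.symm hcd) hax hbx).2 h
  rcases eq_or_ne d x with rfl | hdx
  · simp only [hax, hbx, hcx, if_true, if_false] at h
    exact swap2 ((one hc ha hb hcx hax hbx).2 (swap2 h))
  simpa only [hax, hbx, hcx, hdx, if_false] using h

theorem skewUnit_tmul_mem {N : Submodule ℝ (Matrix ι ι ℝ ⊗[ℝ] Matrix ι ι ℝ)}
    (hN : ∀ Z ∈ skewMat ι, ∀ T ∈ N, adTensor Z T ∈ N) {V : Set ι}
    (hV : ∀ a b c, ∃ y ∈ V, y ≠ a ∧ y ≠ b ∧ y ≠ c)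
    (h : ∀ a ∈ V, ∀ b ∈ V, ∀ c ∈ V, ∀ d ∈ V, skewUnit a b ⊗ₜ[ℝ] skewUnit c d ∈ N)
    (a b c d : ι) : skewUnit a b ⊗ₜ[ℝ] skewUnit c d ∈ N := by
  have hd : ∀ a ∈ V, ∀ b ∈ V, ∀ c ∈ V, ∀ d, skewUnit a b ⊗ₜ[ℝ] skewUnit c d ∈ N := by
    intro a ha b hb c hc d
    by_cases hdV : d ∈ V
    · exact h a ha b hb c hc d hdV
    obtain ⟨y, hy, h1, h2, h3⟩ := hV a b c
    have hyd : y ≠ d := by rintro rfl; exact hdV hy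
    refine skewUnit_tmul_mem_of_replace hN (x := d) hyd.symm h1 h2 h3 hyd ?_
    rw [if_pos rfl]
    exact h _ (by split_ifs <;> assumption) _ (by split_ifs <;> assumption) _
      (by split_ifs <;> assumption) _ hy
  have hc : ∀ a ∈ V, ∀ b ∈ V, ∀ c d, skewUnit a b ⊗ₜ[ℝ] skewUnit c d ∈ N := by
    intro a ha b hb c d
    by_cases hcV : c ∈ V
    · exact hd a ha b hb c hcV d
    obtain ⟨y, hy, h1, h2, h3⟩ := hV a b d
    have hyd : y ≠ c := by rintro rfl; exact hcV hy
    refine skewUnit_tmul_mem_of_replace hN (x := c) hyd.symm h1 h2 hyd h3 ?_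
    rw [if_pos (rfl : c = c)]
    exact hd _ (by split_ifs <;> assumption) _ (by split_ifs <;> assumption) _ hy _
  have hb : ∀ a ∈ V, ∀ b c d, skewUnit a b ⊗ₜ[ℝ] skewUnit c d ∈ N := by
    intro a ha b c d
    by_cases hbV : b ∈ V
    · exact hc a ha b hbV c d
    obtain ⟨y, hy, h1, h2, h3⟩ := hV a c d
    have hyd : y ≠ b := by rintro rfl; exact hbV hy
    refine skewUnit_tmul_mem_of_replace hN (x := b) hyd.symm h1 hyd h2 h3 ?_
    rw [if_pos (rfl : b = b)]
    exact hc _ (by split_ifs <;> assumption) _ hy _ _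
  by_cases haV : a ∈ V
  · exact hb a haV b c d
  obtain ⟨y, hy, h1, h2, h3⟩ := hV b c d
  have hyd : y ≠ a := by rintro rfl; exact haV hy
  refine skewUnit_tmul_mem_of_replace hN (x := a) hyd.symm hyd h1 h2 h3 ?_
  rw [if_pos (rfl : a = a)]
  exact hb _ hy _ _ _

end Generation

end

section

open Matrix

section Transitive

open scoped TensorProduct

variable {ι : Type*} [Fintype ι] [DecidableEq ι]

theorem lie_mat_sub (X A B : Matrix ι ι ℝ) : ⁅X, A - B⁆ = ⁅X, A⁆ - ⁅X, B⁆ :=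
  map_sub (adMat X) A B

theorem sub_lie_mat (X Y A : Matrix ι ι ℝ) : ⁅X - Y, A⁆ = ⁅X, A⁆ - ⁅Y, A⁆ := by
  simp only [LieRing.of_associative_ring_bracket]; noncomm_ring

theorem lie_mat_skew (X A : Matrix ι ι ℝ) : ⁅X, A⁆ = -⁅A, X⁆ := by
  simp only [LieRing.of_associative_ring_bracket]; noncomm_ring

theorem lie_mat_mem_orthogonal {g : Submodule ℝ (Matrix ι ι ℝ)} (hg : g ≤ skewMat ι)
    (hlie : ∀ A ∈ g, ∀ B ∈ g, ⁅A, B⁆ ∈ g) {X Y : Matrix ι ι ℝ} (hX : X ∈ g)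
    (hY : ∀ A ∈ g, frob ι A Y = 0) : ∀ A ∈ g, frob ι A ⁅X, Y⁆ = 0 := by
  intro A hA
  have := frob_lie (hg hX) A Y
  rw [hY _ (hlie _ hX _ hA)] at this
  linarith

theorem lie_mat_eq_zero_of_rows {V : Set ι} {U : Matrix ι ι ℝ} (hU : U ∈ skewMat ι)
    (h : ∀ i ∈ V, ∀ j, U i j = 0) {a b : ι} (ha : a ∈ V) (hb : b ∈ V) :
    ⁅U, skewUnit a b⁆ = 0 := by
  rw [lie_mat_skew, neg_eq_zero]
  have h' : ∀ i ∈ V, ∀ j, U j i = 0 := fun i hi j => by rw [skewMat_apply hU i j, h i hi, neg_zero]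
  ext i j
  rw [lie_skewUnit_apply]
  simp [h a ha, h b hb, h' a ha, h' b hb]

/-- A subalgebra `g` of the skew matrices whose rows in `V` fill out everything, where `V` has at
least four elements, is an ideal. -/
theorem lie_mem_of_transitive {g : Submodule ℝ (Matrix ι ι ℝ)} (hg : g ≤ skewMat ι)
    (hlie : ∀ A ∈ g, ∀ B ∈ g, ⁅A, B⁆ ∈ g) {V : Set ι}
    (hV : ∀ a b c, ∃ y ∈ V, y ≠ a ∧ y ≠ b ∧ y ≠ c)
    (hT : ∀ Z ∈ skewMat ι, ∃ X ∈ g, ∀ i ∈ V, ∀ j, (Z - X) i j = 0)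
    {Z A : Matrix ι ι ℝ} (hZ : Z ∈ skewMat ι) (hA : A ∈ g) : ⁅Z, A⁆ ∈ g := by
  have hc := isCompl_frob_orthogonal g
  set P : Matrix ι ι ℝ →ₗ[ℝ] Matrix ι ι ℝ := g.projection _ hc with hP
  have hPmem : ∀ B, P B ∈ g := fun B => Submodule.projection_apply_mem _ _
  have hPl : ∀ B ∈ g, P B = B := fun B hB => Submodule.projection_apply_of_mem_left hc hB
  have hPorth : ∀ B ∈ (frob ι).orthogonal g, P B = 0 := fun B hB =>
    (Submodule.projection_apply_eq_zero_iff hc).mpr hB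
  have hPlie : ∀ X ∈ g, ∀ B, P ⁅X, B⁆ = ⁅X, P B⁆ := by
    intro X hX B
    have h1 : B - P B ∈ (frob ι).orthogonal g := Submodule.sub_projection_mem hc B
    have h2 : P ⁅X, B - P B⁆ = 0 := hPorth _ (lie_mat_mem_orthogonal hg hlie hX h1)
    rw [lie_mat_sub, map_sub, hPl _ (hlie _ hX _ (hPmem B)), sub_eq_zero] at h2
    exact h2
  set β : Matrix ι ι ℝ ⊗[ℝ] Matrix ι ι ℝ →ₗ[ℝ] ℝ := TensorProduct.lift (LinearMap.comp (frob ι) P) with hβ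
  have hβt : ∀ B C, β (B ⊗ₜ C) = frob ι (P B) C := fun B C => rfl
  have hβ0 : ∀ X ∈ g, ∀ T, β (adTensor X T) = 0 := by
    intro X hX T
    induction T with
    | zero => simp
    | add a b ha hb => rw [map_add, map_add, ha, hb, add_zero]
    | tmul B C => rw [adTensor_tmul, map_add, hβt, hβt, hPlie X hX, frob_lie (hg hX)]; ring
  have hN : ∀ a b c d, skewUnit a b ⊗ₜ[ℝ] skewUnit c d ∈
      productKilled adTensor (skewMat ι : Set (Matrix ι ι ℝ)) β := by
    refine skewUnit_tmul_mem (fun Z hZ T hT => apply_mem_productKilled hT hZ) hV ?_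
    intro a ha b hb c hc d hd l hl hlk
    obtain ⟨m, hm⟩ : ∃ m, l.length = m + 1 :=
      Nat.exists_eq_succ_of_ne_zero (by simpa using hl)
    refine functional_foldr_eq_zero adTensor (g := (g : Set (Matrix ι ι ℝ)))
      (fun z hz x hx => ⟨⁅z, x⁆, lie_mem_skewMat hz (hg hx), adTensor_adTensor z x⟩)
      β hβ0 (fun Z hZ => ?_) m l hm hlk
    obtain ⟨X, hX, hXZ⟩ := hT Z hZ
    have hU : Z - X ∈ skewMat ι := Submodule.sub_mem _ hZ (hg hX)
    have e1 := lie_mat_eq_zero_of_rows hU hXZ ha hb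
    have e2 := lie_mat_eq_zero_of_rows hU hXZ hc hd
    rw [sub_lie_mat, sub_eq_zero] at e1 e2
    exact ⟨X, hX, by rw [adTensor_tmul, adTensor_tmul, e1, e2]⟩
  have hkill : ∀ B ∈ skewMat ι, ∀ C ∈ skewMat ι, β (adTensor Z (B ⊗ₜ C)) = 0 := by
    intro B hB C hC
    refine map_apply_of_mem_productKilled (k := (skewMat ι : Set (Matrix ι ι ℝ))) ?_ hZ
    set N := productKilled adTensor (skewMat ι : Set (Matrix ι ι ℝ)) β
    have h1 : ∀ c d, skewMat ι ≤ N.comap ((TensorProduct.mk ℝ _ _).flip (skewUnit c d)) :=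
      fun c d => skewMat_le_of_skewUnit_mem fun a b => hN a b c d
    have h2 : skewMat ι ≤ N.comap (TensorProduct.mk ℝ _ _ B) :=
      skewMat_le_of_skewUnit_mem fun c d => h1 c d hB
    exact h2 hC
  have hd : P ⁅Z, A⁆ - ⁅Z, A⁆ = 0 := by
    apply frob_self_eq_zero
    have hs : P ⁅Z, A⁆ - ⁅Z, A⁆ ∈ skewMat ι :=
      Submodule.sub_mem _ (hg (hPmem _)) (lie_mem_skewMat hZ (hg hA))
    have := hkill A (hg hA) _ hs
    rw [adTensor_tmul, map_add, hβt, hβt, hPl A hA] at this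
    have h2 := frob_lie hZ A (P ⁅Z, A⁆ - ⁅Z, A⁆)
    rw [LinearMap.map_sub₂]
    linarith
  rw [← sub_eq_zero.mp hd]
  exact hPmem _

end Transitive

end

section

open Matrix

section Corank

variable {ι : Type*} [Fintype ι] [DecidableEq ι]

theorem exists_sub_rows_eq_zero {g : Submodule ℝ (Matrix ι ι ℝ)} (hg : g ≤ skewMat ι)
    (V : Set ι) {Z : Matrix ι ι ℝ} (hZ : Z ∈ skewMat ι)
    (h : ∀ Y ∈ skewMat ι, (∀ X ∈ g, frob ι X Y = 0) → (∀ i ∉ V, ∀ j ∉ V, Y i j = 0) →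
      frob ι Z Y = 0) : ∃ X ∈ g, ∀ i ∈ V, ∀ j, (Z - X) i j = 0 := by
  let W : Submodule ℝ (Matrix ι ι ℝ) :=
    { carrier := {A | A ∈ skewMat ι ∧ ∀ i ∈ V, ∀ j, A i j = 0}
      add_mem' := fun {a b} ha hb => ⟨Submodule.add_mem _ ha.1 hb.1, fun i hi j => by
        rw [Matrix.add_apply, ha.2 i hi, hb.2 i hi, add_zero]⟩
      zero_mem' := ⟨Submodule.zero_mem _, fun _ _ _ => rfl⟩
      smul_mem' := fun c a ha => ⟨Submodule.smul_mem _ _ ha.1, fun i hi j => by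
        rw [Matrix.smul_apply, ha.2 i hi, smul_zero]⟩ }
  have hmem : Z ∈ g ⊔ W := by
    refine mem_of_forall_frob_eq_zero (sup_le hg fun A (hA : A ∈ skewMat ι ∧ _) => hA.1) hZ fun Y hY hYgW => ?_
    refine h Y hY (fun X hX => hYgW X (Submodule.mem_sup_left hX)) fun i hi j hj => ?_
    have hm : skewUnit i j ∈ W := by
      refine ⟨skewUnit_mem i j, fun k hk l => ?_⟩
      have h1 : i ≠ k := by rintro rfl; exact hi hk
      have h2 : j ≠ k := by rintro rfl; exact hj hk
      simp [skewUnit_apply, h1, h2]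
    have := hYgW _ (Submodule.mem_sup_right hm)
    rw [frob_skewUnit_of_mem i j hY] at this
    linarith
  obtain ⟨X, hX, U, hU, rfl⟩ := Submodule.mem_sup.mp hmem
  exact ⟨X, hX, fun i hi j => by rw [add_sub_cancel_left]; exact hU.2 i hi j⟩

theorem lie_eq_zero_of_eq_smul {X Y : Matrix ι ι ℝ} (hX : X ∈ skewMat ι)
    (h : ∃ c : ℝ, ⁅X, Y⁆ = c • Y) : ⁅X, Y⁆ = 0 := by
  obtain ⟨c, hc⟩ := h
  have h1 := frob_lie hX Y Y
  rw [hc, map_smul, map_smul, LinearMap.smul_apply, smul_eq_mul] at h1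
  rw [hc]
  rcases mul_eq_zero.mp (show c * frob ι Y Y = 0 by linarith) with h2 | h2
  · rw [h2, zero_smul]
  · rw [frob_self_eq_zero h2, smul_zero]

/-- If the matrices orthogonal to `g` that vanish on `S × S` are all proportional, then those that
vanish outside of the rows and columns in `V` are zero. -/
theorem eq_zero_of_proportional {g : Submodule ℝ (Matrix ι ι ℝ)} (hg : g ≤ skewMat ι)
    (hlie : ∀ A ∈ g, ∀ B ∈ g, ⁅A, B⁆ ∈ g) {V : Set ι} {o j₀ : ι} (ho : o ∉ V)
    (hj₀ : j₀ ∉ V) (hjo : j₀ ≠ o)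
    (hprop : ∀ Y ∈ skewMat ι, ∀ Y' ∈ skewMat ι, (∀ X ∈ g, frob ι X Y = 0) →
      (∀ X ∈ g, frob ι X Y' = 0) →
      (∀ i ∉ V, ∀ j ∉ V, i ≠ o → j ≠ o → Y i j = 0) →
      (∀ i ∉ V, ∀ j ∉ V, i ≠ o → j ≠ o → Y' i j = 0) → Y ≠ 0 → ∃ c : ℝ, Y' = c • Y)
    {Y : Matrix ι ι ℝ} (hY : Y ∈ skewMat ι) (hYg : ∀ X ∈ g, frob ι X Y = 0)
    (hYV : ∀ i ∉ V, ∀ j ∉ V, Y i j = 0) : Y = 0 := by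
  by_contra hY0
  have hsm : ∀ Y' ∈ skewMat ι, (∀ X ∈ g, frob ι X Y' = 0) →
      (∀ i ∉ V, ∀ j ∉ V, i ≠ o → j ≠ o → Y' i j = 0) → ∃ c : ℝ, Y' = c • Y :=
    fun Y' h1 h2 h3 => hprop Y hY Y' h1 hYg h2 (fun i hi j hj _ _ => hYV i hi j hj) h3 hY0
  have hcomm : ∀ X ∈ g, (∀ i ∉ V, ∀ j ∉ V, ⁅X, Y⁆ i j = 0) → ⁅X, Y⁆ = 0 := fun X hX h =>
    lie_eq_zero_of_eq_smul (hg hX) (hsm _ (lie_mem_skewMat (hg hX) hY)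
      (lie_mat_mem_orthogonal hg hlie hX hYg) fun i hi j hj _ _ => h i hi j hj)
  have hlieapp : ∀ (X : Matrix ι ι ℝ) i j,
      ⁅X, Y⁆ i j = ∑ l, X i l * Y l j - ∑ l, Y i l * X l j := by
    intro X i j
    rw [LieRing.of_associative_ring_bracket, Matrix.sub_apply, mul_apply, mul_apply]
  have key : ∀ j ∉ V, j ≠ o → ∃ X : Matrix ι ι ℝ, (∀ k, X o k = skewUnit j o o k) ∧
      (∀ k, X k o = skewUnit j o k o) ∧
      (∀ i, ∀ a ∈ V, X i a = 0) ∧ ∀ i ∉ V, ∀ a ∈ V, ∑ l, X i l * Y l a = 0 := by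
    intro j hj hjo
    obtain ⟨X, hX, hXV⟩ := exists_sub_rows_eq_zero hg {a | a ∈ V ∨ a = o} (skewUnit_mem j o) (by
      intro Y' hY' hY'g hY'V
      obtain ⟨c, rfl⟩ := hsm Y' hY' hY'g fun i hi k hk hio hko =>
        hY'V i (by simp [hi, hio]) k (by simp [hk, hko])
      rw [map_smul, frob_skewUnit_of_mem _ _ hY, hYV j hj o ho]
      simp)
    have h1 : ∀ k, X o k = skewUnit j o o k := fun k => by
      have := hXV o (Or.inr rfl) k
      rw [Matrix.sub_apply] at this
      linarith
    have h2 : ∀ a ∈ V, ∀ k, X a k = 0 := fun a ha k => by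
      have := hXV a (Or.inl ha) k
      have hja : j ≠ a := by rintro rfl; exact hj ha
      have hoa : o ≠ a := by rintro rfl; exact ho ha
      rw [Matrix.sub_apply, skewUnit_apply] at this
      simp only [hja, hoa, false_and, if_false] at this
      linarith
    have h3 : ∀ k, ∀ a ∈ V, X k a = 0 := fun k a ha => by
      rw [skewMat_apply (hg hX) a k, h2 a ha, neg_zero]
    refine ⟨X, h1, fun k => ?_, h3, fun i hi a ha => ?_⟩
    · rw [skewMat_apply (hg hX) o k, h1, skewMat_apply (skewUnit_mem j o) o k]
    · have h0 : ⁅X, Y⁆ = 0 := hcomm X hX fun i hi k hk => by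
        rw [hlieapp, Finset.sum_eq_zero, Finset.sum_eq_zero, sub_zero]
        · intro l _
          by_cases hl : l ∈ V
          · rw [h2 l hl, mul_zero]
          · rw [hYV i hi l hl, zero_mul]
        · intro l _
          by_cases hl : l ∈ V
          · rw [h3 i l hl, zero_mul]
          · rw [hYV l hl k hk, mul_zero]
      have h4 := hlieapp X i a
      rw [h0, Finset.sum_eq_zero (s := Finset.univ) (f := fun l => Y i l * X l a)
        (fun l _ => by rw [h3 l a ha, mul_zero]), sub_zero] at h4
      exact h4.symm
  have hj : ∀ j ∉ V, j ≠ o → ∀ a ∈ V, Y j a = 0 := by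
    intro j hj hjo a ha
    obtain ⟨X, h1, -, -, h4⟩ := key j hj hjo
    have := h4 o ho a ha
    simpa [h1, skewUnit_apply, hjo] using this
  have hoa : ∀ a ∈ V, Y o a = 0 := by
    intro a ha
    obtain ⟨X, -, h2, h3, h4⟩ := key j₀ hj₀ hjo
    have := h4 j₀ hj₀ a ha
    rw [Finset.sum_eq_single o] at this
    · simpa [h2, skewUnit_apply, hjo] using this
    · intro l _ hlo
      by_cases hl : l ∈ V
      · rw [h3 _ l hl, zero_mul]
      · rw [hj l hl hlo a ha, mul_zero]
    · simp
  have hrow : ∀ i ∉ V, ∀ k, Y i k = 0 := by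
    intro i hi k
    by_cases hk : k ∈ V
    · rcases eq_or_ne i o with rfl | hio
      · exact hoa k hk
      · exact hj i hi hio k hk
    · exact hYV i hi k hk
  have hcol : ∀ i ∉ V, ∀ k, Y k i = 0 := fun i hi k => by
    rw [skewMat_apply hY i k, hrow i hi, neg_zero]
  apply hY0
  ext b a
  by_cases hb : b ∉ V
  · exact hrow b hb a
  by_cases ha : a ∉ V
  · exact hcol a ha b
  rw [not_not] at ha hb
  have hX0 : ∀ X ∈ g, ∑ l, X o l * Y l a = 0 := by
    intro X hX
    have h0 : ⁅X, Y⁆ = 0 := hcomm X hX fun i hi k hk => by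
      rw [hlieapp]
      simp [hrow i hi, hcol k hk]
    have h4 := hlieapp X o a
    rw [h0] at h4
    simp only [hrow o ho, zero_mul, Finset.sum_const_zero, sub_zero] at h4
    exact h4.symm
  obtain ⟨c, hc⟩ := hsm (∑ l, Y l a • skewUnit o l)
    (Submodule.sum_mem _ fun l _ => Submodule.smul_mem _ _ (skewUnit_mem o l))
    (fun X hX => by
      rw [frob_comm, map_sum, LinearMap.sum_apply]
      simp only [map_smul, LinearMap.smul_apply, frob_skewUnit_of_mem _ _ (hg hX), smul_eq_mul]
      have := hX0 X hX
      rw [← mul_zero (2 : ℝ), ← this, Finset.mul_sum]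
      exact Finset.sum_congr rfl fun l _ => by ring)
    (fun i hi k hk hio hko => by
      simp only [Matrix.sum_apply, Matrix.smul_apply, skewUnit_apply]
      refine Finset.sum_eq_zero fun l _ => ?_
      simp [hio.symm, hko.symm])
  have h1 := congrFun (congrFun hc o) b
  have hob : o ≠ b := by rintro rfl; exact ho hb
  simpa [Matrix.sum_apply, skewUnit_apply, hrow o ho, hob, hob.symm] using h1

/-- A subalgebra `g` of the skew matrices is everything provided that the matrices orthogonal to
`g` vanishing on a suitable block are all proportional. -/
theorem eq_skewMat_of_proportional {g : Submodule ℝ (Matrix ι ι ℝ)} (hg : g ≤ skewMat ι)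
    (hlie : ∀ A ∈ g, ∀ B ∈ g, ⁅A, B⁆ ∈ g) {V : Set ι} {o j₀ : ι} (ho : o ∉ V)
    (hj₀ : j₀ ∉ V) (hjo : j₀ ≠ o) (hcard : 6 ≤ Fintype.card ι)
    (hV : ∀ a b c, ∃ y ∈ V, y ≠ a ∧ y ≠ b ∧ y ≠ c)
    (hprop : ∀ Y ∈ skewMat ι, ∀ Y' ∈ skewMat ι, (∀ X ∈ g, frob ι X Y = 0) →
      (∀ X ∈ g, frob ι X Y' = 0) →
      (∀ i ∉ V, ∀ j ∉ V, i ≠ o → j ≠ o → Y i j = 0) →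
      (∀ i ∉ V, ∀ j ∉ V, i ≠ o → j ≠ o → Y' i j = 0) → Y ≠ 0 → ∃ c : ℝ, Y' = c • Y) :
    g = skewMat ι := by
  have hT : ∀ Z ∈ skewMat ι, ∃ X ∈ g, ∀ i ∈ V, ∀ j, (Z - X) i j = 0 := fun Z hZ =>
    exists_sub_rows_eq_zero hg V hZ fun Y hY hYg hYV => by
      rw [eq_zero_of_proportional hg hlie ho hj₀ hjo hprop hY hYg hYV, map_zero]
  obtain ⟨a, ha, -⟩ := hV o o o
  obtain ⟨X, hX, hXV⟩ := hT _ (skewUnit_mem a o)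
  refine le_antisymm hg (skewMat_le_of_ideal hg
    (fun Z hZ A hA => lie_mem_of_transitive hg hlie hV hT hZ hA) hcard hX ?_)
  rintro rfl
  have hao : a ≠ o := by rintro rfl; exact ho ha
  simpa [skewUnit_apply, hao, hao.symm] using hXV a ha o

end Corank

end

section

open Matrix

section Blocks

variable {m n : Type*}

/-- The block-diagonal skew-symmetric matrices. -/
def blockSkew (m n : Type*) : Submodule ℝ (Matrix (m ⊕ n) (m ⊕ n) ℝ) where
  carrier := {A | A ∈ skewMat (m ⊕ n) ∧ ∀ i j, A (Sum.inl i) (Sum.inr j) = 0}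
  add_mem' {a b} ha hb := ⟨Submodule.add_mem _ ha.1 hb.1, fun i j => by
    rw [Matrix.add_apply, ha.2, hb.2, add_zero]⟩
  zero_mem' := ⟨Submodule.zero_mem _, fun _ _ => rfl⟩
  smul_mem' c a ha := ⟨Submodule.smul_mem _ _ ha.1, fun i j => by
    rw [Matrix.smul_apply, ha.2, smul_zero]⟩

theorem blockSkew_le : blockSkew m n ≤ skewMat (m ⊕ n) := fun _ hA => hA.1

theorem fromBlocks_mem_blockSkew {a : Matrix m m ℝ} {d : Matrix n n ℝ} (ha : a ∈ skewMat m)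
    (hd : d ∈ skewMat n) : fromBlocks a 0 0 d ∈ blockSkew m n := by
  refine ⟨?_, fun i j => rfl⟩
  rw [mem_skewMat] at *
  rw [fromBlocks_transpose, ha, hd, fromBlocks_neg]
  simp

theorem exists_fromBlocks_of_mem {A : Matrix (m ⊕ n) (m ⊕ n) ℝ} (hA : A ∈ blockSkew m n) :
    ∃ a ∈ skewMat m, ∃ d ∈ skewMat n, A = fromBlocks a 0 0 d := by
  refine ⟨A.toBlocks₁₁, ?_, A.toBlocks₂₂, ?_, ?_⟩
  · ext i j
    exact skewMat_apply hA.1 (Sum.inl i) (Sum.inl j)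
  · ext i j
    exact skewMat_apply hA.1 (Sum.inr i) (Sum.inr j)
  · ext (i | i) (j | j)
    · rfl
    · exact hA.2 i j
    · show A (Sum.inr i) (Sum.inl j) = 0
      rw [skewMat_apply hA.1 (Sum.inl j) (Sum.inr i), hA.2, neg_zero]
    · rfl

theorem fromBlocks_eq_smul_iff {a a' : Matrix m m ℝ} {d d' : Matrix n n ℝ} {c : ℝ} :
    (fromBlocks a 0 0 d : Matrix (m ⊕ n) (m ⊕ n) ℝ) = c • fromBlocks a' 0 0 d' ↔
      a = c • a' ∧ d = c • d' := by
  rw [fromBlocks_smul, fromBlocks_inj]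
  simp

theorem fromBlocks_eq_zero_iff {a : Matrix m m ℝ} {d : Matrix n n ℝ} :
    (fromBlocks a 0 0 d : Matrix (m ⊕ n) (m ⊕ n) ℝ) = 0 ↔ a = 0 ∧ d = 0 := by
  rw [← fromBlocks_zero, fromBlocks_inj]
  simp

variable [Fintype m] [Fintype n]

theorem frob_fromBlocks (a a' : Matrix m m ℝ) (d d' : Matrix n n ℝ) :
    frob (m ⊕ n) (fromBlocks a 0 0 d) (fromBlocks a' 0 0 d') = frob m a a' + frob n d d' := by
  simp [frob_eq_sum]

theorem lie_fromBlocks (a a' : Matrix m m ℝ) (d d' : Matrix n n ℝ) :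
    ⁅fromBlocks a 0 0 d, fromBlocks a' 0 0 d'⁆ = fromBlocks ⁅a, a'⁆ 0 0 ⁅d, d'⁆ := by
  simp [Ring.lie_def, fromBlocks_multiply, sub_eq_add_neg, fromBlocks_neg, fromBlocks_add]

theorem lie_mem_blockSkew {A B : Matrix (m ⊕ n) (m ⊕ n) ℝ} (hA : A ∈ blockSkew m n)
    (hB : B ∈ blockSkew m n) : ⁅A, B⁆ ∈ blockSkew m n := by
  classical
  obtain ⟨a, ha, d, hd, rfl⟩ := exists_fromBlocks_of_mem hA
  obtain ⟨a', ha', d', hd', rfl⟩ := exists_fromBlocks_of_mem hB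
  rw [lie_fromBlocks]
  exact fromBlocks_mem_blockSkew (lie_mem_skewMat ha ha') (lie_mem_skewMat hd hd')

theorem eq_zero_of_lie_eq_zero [DecidableEq n] (hn : ∀ a b : n, ∃ c, c ≠ a ∧ c ≠ b)
    {y : Matrix n n ℝ} (hy : y ∈ skewMat n) (h : ∀ z ∈ skewMat n, ⁅z, y⁆ = 0) : y = 0 := by
  ext a b
  rcases eq_or_ne a b with rfl | hab
  · exact skewMat_diag hy a
  obtain ⟨c, hca, hcb⟩ := hn a b
  have := congrFun (congrFun (h _ (skewUnit_mem c a)) c) b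
  rw [lie_skewUnit_apply] at this
  simpa [hca, hcb.symm, hab.symm] using this

/-- A subalgebra `g` of the block-diagonal skew matrices is everything provided that the elements
orthogonal to `g` vanishing on the last coordinates of the first factor are all proportional. -/
theorem eq_blockSkew_of_proportional {p q : ℕ} (hq : 5 ≤ q) (hqp : q + 2 ≤ p)
    {g : Submodule ℝ (Matrix (Fin p ⊕ Fin q) (Fin p ⊕ Fin q) ℝ)}
    (hg : g ≤ blockSkew (Fin p) (Fin q)) (hlie : ∀ A ∈ g, ∀ B ∈ g, ⁅A, B⁆ ∈ g)
    (hprop : ∀ Y ∈ blockSkew (Fin p) (Fin q), ∀ Y' ∈ blockSkew (Fin p) (Fin q),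
      (∀ X ∈ g, frob _ X Y = 0) → (∀ X ∈ g, frob _ X Y' = 0) →
      (∀ i j : Fin p, q ≤ i → q ≤ j → Y (Sum.inl i) (Sum.inl j) = 0) →
      (∀ i j : Fin p, q ≤ i → q ≤ j → Y' (Sum.inl i) (Sum.inl j) = 0) → Y ≠ 0 →
      ∃ c : ℝ, Y' = c • Y) :
    g = blockSkew (Fin p) (Fin q) := by
  have hgs : g ≤ skewMat _ := hg.trans blockSkew_le
  have h1 : ∀ a ∈ skewMat (Fin p), ∃ d ∈ skewMat (Fin q), fromBlocks a 0 0 d ∈ g := by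
    let g₁ : Submodule ℝ (Matrix (Fin p) (Fin p) ℝ) :=
      { carrier := {a | ∃ d ∈ skewMat (Fin q), fromBlocks a 0 0 d ∈ g}
        add_mem' := by
          rintro a a' ⟨d, hd, h⟩ ⟨d', hd', h'⟩
          refine ⟨d + d', Submodule.add_mem _ hd hd', ?_⟩
          have := g.add_mem h h'
          rwa [fromBlocks_add, add_zero, add_zero] at this
        zero_mem' := ⟨0, Submodule.zero_mem _, by rw [fromBlocks_zero]; exact g.zero_mem⟩
        smul_mem' := by
          rintro c a ⟨d, hd, h⟩
          refine ⟨c • d, Submodule.smul_mem _ c hd, ?_⟩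
          have := g.smul_mem c h
          rwa [fromBlocks_smul, smul_zero, smul_zero] at this }
    have hg₁ : g₁ ≤ skewMat (Fin p) := by
      rintro a ⟨d, hd, h⟩
      obtain ⟨a', ha', d', -, h2⟩ := exists_fromBlocks_of_mem (hg h)
      rwa [(fromBlocks_inj.mp h2).1]
    have horth : ∀ y, (∀ x ∈ g₁, frob _ x y = 0) → ∀ X ∈ g, frob _ X (fromBlocks y 0 0 0) = 0 := by
      intro y hy X hX
      obtain ⟨a, ha, d, hd, rfl⟩ := exists_fromBlocks_of_mem (hg hX)
      rw [frob_fromBlocks, hy a ⟨d, hd, hX⟩, map_zero, add_zero]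
    have heq : g₁ = skewMat (Fin p) := by
      refine eq_skewMat_of_proportional hg₁ ?_ (V := {i : Fin p | (i : ℕ) < 4})
        (o := ⟨4, by omega⟩) (j₀ := ⟨5, by omega⟩) (by simp) (by simp) (by simp)
        (by simp; omega) ?_ ?_
      · rintro a ⟨d, hd, h⟩ a' ⟨d', hd', h'⟩
        have := hlie _ h _ h'
        rw [lie_fromBlocks] at this
        exact ⟨_, lie_mem_skewMat hd hd', this⟩
      · intro a b c
        have : ∃ k < 4, k ≠ (a : ℕ) ∧ k ≠ (b : ℕ) ∧ k ≠ (c : ℕ) := by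
          by_contra! hcon
          have h0 := hcon 0
          have h1 := hcon 1
          have h2 := hcon 2
          have h3 := hcon 3
          omega
        obtain ⟨k, hk, h1, h2, h3⟩ := this
        exact ⟨⟨k, by omega⟩, hk, fun h => h1 (congrArg Fin.val h), fun h => h2 (congrArg Fin.val h),
          fun h => h3 (congrArg Fin.val h)⟩
      · intro Y hY Y' hY' hYg hY'g hYS hY'S hY0
        have key : ∀ i : Fin p, q ≤ i → i ∉ {i : Fin p | (i : ℕ) < 4} ∧ i ≠ ⟨4, by omega⟩ := by
          intro i hi
          simp only [Set.mem_ofPred_eq, ne_eq, Fin.ext_iff]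
          omega
        obtain ⟨c, hc⟩ := hprop _ (fromBlocks_mem_blockSkew hY (Submodule.zero_mem _)) _
          (fromBlocks_mem_blockSkew hY' (Submodule.zero_mem _)) (horth Y hYg) (horth Y' hY'g)
          (fun i j hi hj => hYS i (key i hi).1 j (key j hj).1 (key i hi).2 (key j hj).2)
          (fun i j hi hj => hY'S i (key i hi).1 j (key j hj).1 (key i hi).2 (key j hj).2)
          (fun h => hY0 (fromBlocks_eq_zero_iff.mp h).1)
        exact ⟨c, (fromBlocks_eq_smul_iff.mp hc).1⟩
    intro a ha
    rw [← heq] at ha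
    exact ha
  have h2 : ∀ y ∈ skewMat (Fin q), (∀ X ∈ g, frob _ X (fromBlocks 0 0 0 y) = 0) → y = 0 := by
    intro y hy hyg
    set Y : Matrix (Fin p ⊕ Fin q) (Fin p ⊕ Fin q) ℝ := fromBlocks 0 0 0 y with hYdef
    have hYk : Y ∈ blockSkew (Fin p) (Fin q) :=
      fromBlocks_mem_blockSkew (Submodule.zero_mem _) hy
    by_contra hy0
    have hY0 : Y ≠ 0 := fun h => hy0 (fromBlocks_eq_zero_iff.mp h).2
    have hlow : ∀ B ∈ blockSkew (Fin p) (Fin q), ∃ d ∈ skewMat (Fin q), ⁅B, Y⁆ = fromBlocks 0 0 0 d := by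
      intro B hB
      obtain ⟨a, ha, d, hd, rfl⟩ := exists_fromBlocks_of_mem hB
      exact ⟨_, lie_mem_skewMat hd hy, by
        rw [lie_fromBlocks]; simp [LieRing.of_associative_ring_bracket]⟩
    have hcomm : ∀ B ∈ blockSkew (Fin p) (Fin q), (∀ X ∈ g, frob _ X ⁅B, Y⁆ = 0) → ⁅B, Y⁆ = 0 := by
      intro B hB hBg
      refine lie_eq_zero_of_eq_smul hB.1 (hprop Y hYk _ (lie_mem_blockSkew hB hYk) hyg hBg
        (fun _ _ _ _ => rfl) ?_ hY0)
      obtain ⟨d, -, hd⟩ := hlow B hB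
      rw [hd]
      exact fun _ _ _ _ => rfl
    have hgY : ∀ X ∈ g, ⁅X, Y⁆ = 0 := fun X hX =>
      hcomm X (hg hX) (lie_mat_mem_orthogonal hgs hlie hX hyg)
    refine hy0 (eq_zero_of_lie_eq_zero (fun a b => ?_) hy fun z hz => ?_)
    · have : ∃ k < 3, k ≠ (a : ℕ) ∧ k ≠ (b : ℕ) := by
        by_contra! hcon
        have h0 := hcon 0
        have h1 := hcon 1
        have h2 := hcon 2
        omega
      obtain ⟨k, hk, h1, h2⟩ := this
      exact ⟨⟨k, by omega⟩, fun h => h1 (congrArg Fin.val h), fun h => h2 (congrArg Fin.val h)⟩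
    · have hZ := fromBlocks_mem_blockSkew (Submodule.zero_mem (skewMat (Fin p))) hz
      have := hcomm _ hZ (fun X hX => by
        rw [lie_mat_skew, map_neg, neg_eq_zero]
        have := frob_lie hYk.1 X (fromBlocks 0 0 0 z)
        rw [lie_mat_skew Y X, hgY X hX, neg_zero, map_zero, LinearMap.zero_apply] at this
        linarith)
      rw [lie_fromBlocks] at this
      exact (fromBlocks_eq_zero_iff.mp this).2
  refine le_antisymm hg fun Z hZ => mem_of_forall_frob_eq_zero hg hZ fun Y hY hYg => ?_
  suffices h : Y = 0 by rw [h, map_zero]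
  obtain ⟨y, hy, d, hd, rfl⟩ := exists_fromBlocks_of_mem hY
  by_contra hY0
  have hy0 : y ≠ 0 := by
    rintro rfl
    exact hY0 (by rw [h2 d hd hYg, fromBlocks_zero])
  let n₁ : Submodule ℝ (Matrix (Fin p) (Fin p) ℝ) :=
    { carrier := {a | a ∈ skewMat (Fin p) ∧ ∃ d ∈ skewMat (Fin q),
        ∀ X ∈ g, frob _ X (fromBlocks a 0 0 d) = 0}
      add_mem' := by
        rintro a a' ⟨ha, d, hd, h⟩ ⟨ha', d', hd', h'⟩
        refine ⟨Submodule.add_mem _ ha ha', d + d', Submodule.add_mem _ hd hd', fun X hX => ?_⟩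
        have : (fromBlocks (a + a') 0 0 (d + d') : Matrix (Fin p ⊕ Fin q) (Fin p ⊕ Fin q) ℝ)
          = fromBlocks a 0 0 d + fromBlocks a' 0 0 d' := by
          rw [fromBlocks_add, add_zero, add_zero]
        rw [this, map_add, h X hX, h' X hX, add_zero]
      zero_mem' := ⟨Submodule.zero_mem _, 0, Submodule.zero_mem _, fun X hX => by
        rw [fromBlocks_zero, map_zero]⟩
      smul_mem' := by
        rintro c a ⟨ha, d, hd, h⟩
        refine ⟨Submodule.smul_mem _ c ha, c • d, Submodule.smul_mem _ c hd, fun X hX => ?_⟩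
        have : (fromBlocks (c • a) 0 0 (c • d) : Matrix (Fin p ⊕ Fin q) (Fin p ⊕ Fin q) ℝ)
          = c • fromBlocks a 0 0 d := by
          rw [fromBlocks_smul, smul_zero, smul_zero]
        rw [this, map_smul, h X hX, smul_zero] }
  have hall : skewMat (Fin p) ≤ n₁ := by
    refine skewMat_le_of_ideal (fun a ha => ha.1) ?_ (by simp; omega) (Y := y) ⟨hy, d, hd, hYg⟩ hy0
    rintro z hz a ⟨ha, d, hd, h⟩
    obtain ⟨e, he, hze⟩ := h1 z hz
    refine ⟨lie_mem_skewMat hz ha, ⁅e, d⁆, lie_mem_skewMat he hd, ?_⟩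
    rw [← lie_fromBlocks]
    exact lie_mat_mem_orthogonal hgs hlie hze h
  let i₀ : Fin p := ⟨0, by omega⟩
  let i₁ : Fin p := ⟨1, by omega⟩
  let i₂ : Fin p := ⟨2, by omega⟩
  have hW : ∀ k i j : Fin p, q ≤ i → q ≤ j → skewUnit i₀ k i j = 0 := by
    intro k i j hi hj
    have e1 : i₀ ≠ i := by rintro rfl; simp [i₀] at hi; omega
    have e2 : i₀ ≠ j := by rintro rfl; simp [i₀] at hj; omega
    simp [skewUnit_apply, e1, e2]
  obtain ⟨hs, d₁, hd₁, he₁⟩ := hall (skewUnit_mem i₀ i₁)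
  obtain ⟨hs', d₂, hd₂, he₂⟩ := hall (skewUnit_mem i₀ i₂)
  have e01 : i₀ ≠ i₁ := by simp [i₀, i₁]
  have e02 : i₀ ≠ i₂ := by simp [i₀, i₂]
  have e12 : i₁ ≠ i₂ := by simp [i₁, i₂]
  obtain ⟨c, hc⟩ := hprop _ (fromBlocks_mem_blockSkew hs hd₁) _ (fromBlocks_mem_blockSkew hs' hd₂)
    he₁ he₂ (hW i₁) (hW i₂) (fun h => by
      have := congrFun (congrFun (fromBlocks_eq_zero_iff.mp h).1 i₀) i₁
      simp [skewUnit_apply, e01.symm] at this)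
  have := congrFun (congrFun (fromBlocks_eq_smul_iff.mp hc).1 i₀) i₂
  simp [skewUnit_apply, e02.symm, e12, e01.symm] at this

end Blocks

end

section

open Matrix

section MatrixExp

open Filter Topology
open scoped Matrix.Norms.L2Operator
open NormedSpace (exp)

variable {n : Type*} [Fintype n] [DecidableEq n]

theorem norm_le_one_of_mem_unitary {U : Matrix n n ℝ} (hU : U ∈ unitary (Matrix n n ℝ)) :
    ‖U‖ ≤ 1 := by
  rcases subsingleton_or_nontrivial (Matrix n n ℝ) with h | h
  · rw [Subsingleton.elim U 0, norm_zero]; exact zero_le_one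
  · exact (CStarRing.norm_of_mem_unitary hU).le

theorem hasDerivAt_exp_smul (X : Matrix n n ℝ) (t : ℝ) :
    HasDerivAt (fun s : ℝ => exp (s • X)) (exp (t • X) * X) t :=
  hasDerivAt_exp_smul_const X t

theorem exp_add_smul_mat (X : Matrix n n ℝ) (s t : ℝ) :
    exp ((s + t) • X) = exp (s • X) * exp (t • X) := by
  rw [add_smul]
  exact Matrix.exp_add_of_commute _ _ (((Commute.refl X).smul_left s).smul_right t)

theorem continuous_exp_smul (X : Matrix n n ℝ) : Continuous fun s : ℝ => exp (s • X) :=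
  continuous_iff_continuousAt.mpr fun t => (hasDerivAt_exp_smul X t).continuousAt

theorem star_exp_of_mem_skewMat {X : Matrix n n ℝ} (hX : X ∈ skewMat n) (s : ℝ) :
    star (exp (s • X)) = exp ((-s) • X) := by
  rw [star_eq_conjTranspose, ← Matrix.exp_conjTranspose, conjTranspose_smul,
    conjTranspose_eq_transpose_of_trivial, mem_skewMat.mp hX]
  simp

theorem exp_smul_mem_unitary {X : Matrix n n ℝ} (hX : X ∈ skewMat n) (s : ℝ) :
    exp (s • X) ∈ unitary (Matrix n n ℝ) := by
  rw [Unitary.mem_iff, star_exp_of_mem_skewMat hX, ← exp_add_smul_mat, ← exp_add_smul_mat]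
  simp

theorem norm_pow_sub_pow_le {x y : Matrix n n ℝ} (hx : x ∈ unitary (Matrix n n ℝ))
    (hy : y ∈ unitary (Matrix n n ℝ)) (m : ℕ) : ‖x ^ m - y ^ m‖ ≤ m * ‖x - y‖ := by
  induction m with
  | zero => simp
  | succ m ih =>
    have h : x ^ (m + 1) - y ^ (m + 1) = x * (x ^ m - y ^ m) + (x - y) * y ^ m := by
      rw [pow_succ' x, pow_succ' y]; noncomm_ring
    rw [h]
    calc _ ≤ ‖x * (x ^ m - y ^ m)‖ + ‖(x - y) * y ^ m‖ := norm_add_le _ _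
      _ ≤ ‖x‖ * ‖x ^ m - y ^ m‖ + ‖x - y‖ * ‖y ^ m‖ :=
        add_le_add (norm_mul_le _ _) (norm_mul_le _ _)
      _ ≤ 1 * (m * ‖x - y‖) + ‖x - y‖ * 1 := by
        gcongr
        · exact norm_le_one_of_mem_unitary hx
        · exact norm_le_one_of_mem_unitary (pow_mem hy m)
      _ = _ := by push_cast; ring

/-- A closed group of orthogonal matrices. -/
structure IsClosedOrthGroup (G : Set (Matrix n n ℝ)) : Prop where
  isMatSubgroup : IsMatSubgroup G
  subset_unitary : ∀ a ∈ G, a ∈ unitary (Matrix n n ℝ)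
  isClosed : IsClosed G

variable {G : Set (Matrix n n ℝ)}

theorem IsClosedOrthGroup.pow_mem (hG : IsClosedOrthGroup G) {a : Matrix n n ℝ} (ha : a ∈ G)
    (m : ℕ) : a ^ m ∈ G := by
  induction m with
  | zero => rw [pow_zero]; exact hG.1.1
  | succ m ih => rw [pow_succ]; exact hG.1.2.1 _ ih _ ha

theorem mem_skewMat_of_tendsto {α : Type*} {l : Filter α} [l.NeBot] {x : α → Matrix n n ℝ}
    {r : α → ℝ} {ξ : Matrix n n ℝ} (hx : ∀ᶠ t in l, x t ∈ unitary (Matrix n n ℝ))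
    (hr : ∀ᶠ t in l, 0 < r t) (hr0 : Tendsto r l (𝓝 0))
    (hξ : Tendsto (fun t => (r t)⁻¹ • (x t - 1)) l (𝓝 ξ)) : ξ ∈ skewMat n := by
  have h1 : Tendsto (fun t => star ((r t)⁻¹ • (x t - 1)) + (r t)⁻¹ • (x t - 1)
      + r t • (star ((r t)⁻¹ • (x t - 1)) * ((r t)⁻¹ • (x t - 1)))) l
      (𝓝 (star ξ + ξ + (0 : ℝ) • (star ξ * ξ))) :=
    (hξ.star.add hξ).add (hr0.smul (hξ.star.mul hξ))
  have h2 : Tendsto (fun t => star ((r t)⁻¹ • (x t - 1)) + (r t)⁻¹ • (x t - 1)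
      + r t • (star ((r t)⁻¹ • (x t - 1)) * ((r t)⁻¹ • (x t - 1)))) l (𝓝 0) := by
    refine tendsto_const_nhds.congr' ?_
    filter_upwards [hx, hr] with t ht hrt
    have h3 : star (x t) * x t = 1 := ht.1
    simp only [star_smul, star_sub, star_one, star_trivial, Matrix.smul_mul, Matrix.mul_smul,
      sub_mul, mul_sub, h3, one_mul, mul_one, smul_smul, mul_inv_cancel₀ hrt.ne']
    module
  have h3 := tendsto_nhds_unique h1 h2
  rw [zero_smul, add_zero, star_eq_conjTranspose, conjTranspose_eq_transpose_of_trivial] at h3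
  exact eq_neg_of_add_eq_zero_left h3

/-- The key step in Cartan's closed subgroup theorem: limiting directions of a closed group at
the identity generate one-parameter subgroups. -/
theorem IsClosedOrthGroup.exp_smul_mem_of_tendsto (hG : IsClosedOrthGroup G) {α : Type*}
    {l : Filter α} [l.NeBot] {x : α → Matrix n n ℝ} {r : α → ℝ} {ξ : Matrix n n ℝ}
    (hx : ∀ᶠ t in l, x t ∈ G) (hr : ∀ᶠ t in l, 0 < r t) (hr0 : Tendsto r l (𝓝 0))
    (hξ : Tendsto (fun t => (r t)⁻¹ • (x t - 1)) l (𝓝 ξ)) (s : ℝ) : exp (s • ξ) ∈ G := by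
  have hskew : ξ ∈ skewMat n :=
    mem_skewMat_of_tendsto (hx.mono fun t ht => hG.2 _ ht) hr hr0 hξ
  have hpos : ∀ s : ℝ, 0 ≤ s → exp (s • ξ) ∈ G := by
    intro s hs
    have hmr : Tendsto (fun t => (⌊s / r t⌋₊ : ℝ) * r t) l (𝓝 s) := by
      refine tendsto_of_tendsto_of_tendsto_of_le_of_le' (g := fun t => s - r t)
        (h := fun _ => s) ?_ tendsto_const_nhds ?_ ?_
      · simpa using tendsto_const_nhds.sub hr0
      · filter_upwards [hr] with t ht
        have := Nat.lt_floor_add_one (s / r t)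
        rw [div_lt_iff₀ ht] at this
        linarith
      · filter_upwards [hr] with t ht
        have := Nat.floor_le (div_nonneg hs ht.le)
        rwa [le_div_iff₀ ht] at this
    have hexp : Tendsto (fun t => (r t)⁻¹ • (exp (r t • ξ) - 1)) l (𝓝 ξ) := by
      have h1 := (hasDerivAt_exp_smul ξ 0).tendsto_slope
      simp only [zero_smul, NormedSpace.exp_zero, one_mul] at h1
      have h2 : Tendsto r l (𝓝[≠] 0) :=
        tendsto_nhdsWithin_iff.mpr ⟨hr0, hr.mono fun t ht => ht.ne'⟩
      refine (h1.comp h2).congr fun t => ?_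
      simp [slope_def_module]
    have hsub : Tendsto (fun t => x t ^ ⌊s / r t⌋₊ - exp (r t • ξ) ^ ⌊s / r t⌋₊) l (𝓝 0) := by
      have h1 : Tendsto (fun t => ((⌊s / r t⌋₊ : ℝ) * r t) *
          ‖(r t)⁻¹ • (x t - 1) - (r t)⁻¹ • (exp (r t • ξ) - 1)‖) l (𝓝 (s * ‖ξ - ξ‖)) :=
        hmr.mul (hξ.sub hexp).norm
      rw [sub_self, norm_zero, mul_zero] at h1
      refine squeeze_zero_norm' ?_ h1
      filter_upwards [hr, hx] with t ht hxt
      refine (norm_pow_sub_pow_le (hG.2 _ hxt) (exp_smul_mem_unitary hskew _) _).trans_eq ?_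
      rw [← smul_sub, sub_sub_sub_cancel_right, norm_smul, norm_inv, Real.norm_of_nonneg ht.le]
      field_simp
    have hy : Tendsto (fun t => exp (r t • ξ) ^ ⌊s / r t⌋₊) l (𝓝 (exp (s • ξ))) := by
      refine (((continuous_exp_smul ξ).tendsto s).comp hmr).congr fun t => ?_
      rw [← Matrix.exp_nsmul, Function.comp_apply, ← Nat.cast_smul_eq_nsmul ℝ, smul_smul]
    have hfin := hsub.add hy
    simp only [sub_add_cancel, zero_add] at hfin
    exact hG.isClosed.mem_of_tendsto hfin (hx.mono fun t ht => hG.pow_mem ht _)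
  rcases le_total 0 s with hs | hs
  · exact hpos s hs
  · have := hG.1.2.2 _ (hpos (-s) (by linarith))
    rwa [star_exp_of_mem_skewMat hskew, neg_neg] at this

end MatrixExp

end

section

open Matrix

theorem mul_mul_star_mem_skewMat {m : Type*} [Fintype m] {X : Matrix m m ℝ}
    (hX : X ∈ skewMat m) (U : Matrix m m ℝ) :
    U * X * star U ∈ skewMat m := by
  rw [mem_skewMat] at hX ⊢
  rw [star_eq_conjTranspose, conjTranspose_eq_transpose_of_trivial]
  simp [Matrix.transpose_mul, hX, Matrix.mul_assoc]

section LieSubspace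

open Filter Topology
open scoped Matrix.Norms.L2Operator
open NormedSpace (exp)

variable {n : Type*} [Fintype n] [DecidableEq n] {G : Set (Matrix n n ℝ)}

/-- The Lie algebra of a closed group of orthogonal matrices. -/
def IsClosedOrthGroup.lieSub (hG : IsClosedOrthGroup G) : Submodule ℝ (Matrix n n ℝ) where
  carrier := {X | X ∈ skewMat n ∧ ∀ s : ℝ, exp (s • X) ∈ G}
  zero_mem' := ⟨zero_mem _, fun s => by simpa using hG.1.1⟩
  smul_mem' c X hX := ⟨Submodule.smul_mem _ c hX.1, fun s => by
    rw [smul_smul]; exact hX.2 _⟩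
  add_mem' {X Y} hX hY := ⟨add_mem hX.1 hY.1, by
    have hd : HasDerivAt (fun t : ℝ => exp (t • X) * exp (t • Y)) (X + Y) 0 := by
      have h := (hasDerivAt_exp_smul X 0).mul (hasDerivAt_exp_smul Y 0)
      simp only [zero_smul, NormedSpace.exp_zero, one_mul, mul_one] at h
      exact h
    refine hG.exp_smul_mem_of_tendsto (l := 𝓝[>] (0 : ℝ)) (r := fun t => t)
      (Eventually.of_forall fun t => hG.1.2.1 _ (hX.2 t) _ (hY.2 t)) self_mem_nhdsWithin
      (tendsto_id.mono_left nhdsWithin_le_nhds) ?_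
    refine (hd.tendsto_slope.mono_left (nhdsWithin_mono _ fun t ht => ne_of_gt ht)).congr
      fun t => ?_
    simp [slope_def_module]⟩

theorem exp_smul_conj {U : Matrix n n ℝ} (hU : U ∈ unitary (Matrix n n ℝ)) (X : Matrix n n ℝ)
    (s : ℝ) : exp (s • (U * X * star U)) = U * exp (s • X) * star U := by
  have h1 : star U = U⁻¹ := (Matrix.inv_eq_left_inv hU.1).symm
  have hu : IsUnit U := .of_mul_eq_one (star U) hU.2
  rw [h1, ← Matrix.exp_conj U (s • X) hu]
  simp

theorem IsClosedOrthGroup.conj_mem_lieSub (hG : IsClosedOrthGroup G) {a X : Matrix n n ℝ}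
    (ha : a ∈ G) (hX : X ∈ hG.lieSub) : a * X * star a ∈ hG.lieSub :=
  ⟨mul_mul_star_mem_skewMat hX.1 a, fun s => by
    rw [exp_smul_conj (hG.2 a ha)]
    exact hG.1.2.1 _ (hG.1.2.1 _ ha _ (hX.2 s)) _ (hG.1.2.2 _ ha)⟩

theorem hasDerivAt_exp_conj {X : Matrix n n ℝ} (hX : X ∈ skewMat n) (Y : Matrix n n ℝ) :
    HasDerivAt (fun t : ℝ => exp (t • X) * Y * star (exp (t • X))) ⁅X, Y⁆ 0 := by
  have h1 : HasDerivAt (fun t : ℝ => exp (t • X)) X 0 := by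
    simpa using hasDerivAt_exp_smul X 0
  have h2 : HasDerivAt (fun t : ℝ => star (exp (t • X))) (-X) 0 := by
    have : HasDerivAt (fun t : ℝ => exp (t • (-X))) (-X) 0 := by
      simpa using hasDerivAt_exp_smul (-X) 0
    refine this.congr_of_eventuallyEq (Eventually.of_forall fun t => ?_)
    simp only [star_exp_of_mem_skewMat hX, neg_smul, smul_neg]
  have h3 := (h1.mul_const Y).mul h2
  simp only [zero_smul, NormedSpace.exp_zero, star_one, mul_one, one_mul] at h3
  rw [Ring.lie_def]
  rwa [mul_neg, ← sub_eq_add_neg] at h3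

theorem IsClosedOrthGroup.lie_mem_lieSub (hG : IsClosedOrthGroup G) {X Y : Matrix n n ℝ}
    (hX : X ∈ hG.lieSub) (hY : Y ∈ hG.lieSub) : ⁅X, Y⁆ ∈ hG.lieSub := by
  have hcl : IsClosed (hG.lieSub : Set (Matrix n n ℝ)) := hG.lieSub.closed_of_finiteDimensional
  have h := (hasDerivAt_exp_conj hX.1 Y).tendsto_slope
  refine hcl.mem_of_tendsto h (Eventually.of_forall fun t => ?_)
  rw [slope_def_module]
  exact hG.lieSub.smul_mem _ (sub_mem (hG.conj_mem_lieSub (hX.2 t) hY)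
    (hG.conj_mem_lieSub (hX.2 0) hY))

end LieSubspace

end

section

open Matrix

section Orbit

open Filter Topology
open scoped Matrix.Norms.L2Operator
open NormedSpace (exp)

variable {n : Type*} [Fintype n] [DecidableEq n] {G H : Set (Matrix n n ℝ)}

theorem IsClosedOrthGroup.isCompact (hG : IsClosedOrthGroup G) : IsCompact G := by
  have : ProperSpace (Matrix n n ℝ) := FiniteDimensional.proper ℝ _
  refine (isCompact_closedBall (0 : Matrix n n ℝ) 1).of_isClosed_subset hG.isClosed fun a ha => ?_
  simpa using norm_le_one_of_mem_unitary (hG.2 a ha)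

theorem eq_one_of_trace_one_le {a : Matrix n n ℝ} (ha : a ∈ unitary (Matrix n n ℝ))
    (h : trace (1 : Matrix n n ℝ) ≤ trace a) : a = 1 := by
  have h1 : frob n (a - 1) (a - 1) = 2 * trace (1 : Matrix n n ℝ) - 2 * trace a := by
    have h2 : aᵀ * a = 1 := by
      have := ha.1
      rwa [star_eq_conjTranspose, conjTranspose_eq_transpose_of_trivial] at this
    rw [frob_apply, transpose_sub, transpose_one, sub_mul, mul_sub, mul_sub, h2]
    simp only [mul_one, one_mul, trace_sub, trace_transpose]
    ring
  have h2 : 0 ≤ frob n (a - 1) (a - 1) := by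
    rw [frob_eq_sum]
    exact Finset.sum_nonneg fun i _ => Finset.sum_nonneg fun j _ => mul_self_nonneg _
  exact sub_eq_zero.mp (frob_self_eq_zero (le_antisymm (by linarith) h2))

theorem trace_mul_eq_zero_of_isLocalMax {A B ξ : Matrix n n ℝ}
    (h : ∀ s : ℝ, trace (A * exp (s • ξ)) + trace (B * exp (s • ξ)) ≤ trace A + trace B) :
    trace (A * ξ) + trace (B * ξ) = 0 := by
  have h0 : HasDerivAt (fun s : ℝ => exp (s • ξ)) ξ 0 := by
    have := hasDerivAt_exp_smul ξ 0
    simp only [zero_smul, NormedSpace.exp_zero, one_mul] at this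
    exact this
  have ht : ∀ C : Matrix n n ℝ, HasDerivAt (fun s : ℝ => trace (C * exp (s • ξ)))
      (trace (C * ξ)) 0 := fun C =>
    (LinearMap.toContinuousLinearMap
      ((traceLinearMap n ℝ ℝ) ∘ₗ (LinearMap.mulLeft ℝ C))).hasFDerivAt.comp_hasDerivAt 0 h0
  refine IsLocalMax.hasDerivAt_eq_zero (f := fun s : ℝ =>
    trace (A * exp (s • ξ)) + trace (B * exp (s • ξ))) (a := 0) ?_ ((ht A).add (ht B))
  exact Eventually.of_forall fun s => by simpa using h s

theorem exists_lift_maximizing_trace (hG : IsClosedOrthGroup G) (hH : IsClosedOrthGroup H)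
    {x : Matrix n n ℝ} (hx : ∃ a ∈ G, ∃ b ∈ H, x = a * star b) :
    ∃ a ∈ G, ∃ b ∈ H, x = a * star b ∧ ∀ a' ∈ G, ∀ b' ∈ H, x = a' * star b' →
      trace a' + trace b' ≤ trace a + trace b := by
  have hK : IsCompact ((G ×ˢ H) ∩ {y : Matrix n n ℝ × Matrix n n ℝ | x = y.1 * star y.2}) :=
    (hG.isCompact.prod hH.isCompact).inter_right
      (isClosed_eq continuous_const (continuous_fst.mul continuous_snd.star))
  obtain ⟨a, ha, b, hb, hab⟩ := hx
  obtain ⟨y, ⟨hy1, hy2⟩, hy⟩ := hK.exists_isMaxOn ⟨(a, b), ⟨ha, hb⟩, hab⟩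
    (f := fun y => trace y.1 + trace y.2)
    ((continuous_fst.matrix_trace.add continuous_snd.matrix_trace).continuousOn)
  exact ⟨y.1, hy1.1, y.2, hy1.2, hy2, fun a' ha' b' hb' h => hy (a := (a', b')) ⟨⟨ha', hb'⟩, h⟩⟩

theorem exists_lieSub_sub_of_hasDerivAt (hG : IsClosedOrthGroup G) (hH : IsClosedOrthGroup H)
    {c : ℝ → Matrix n n ℝ} {w : Matrix n n ℝ} (hc : ∀ t, ∃ a ∈ G, ∃ b ∈ H, c t = a * star b)
    (hc0 : c 0 = 1) (hw : HasDerivAt c w 0) :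
    ∃ X ∈ hG.lieSub, ∃ Z ∈ hH.lieSub, w = X - Z := by
  choose g hg h hh hgh hmax using fun t => exists_lift_maximizing_trace hG hH (hc t)
  obtain ⟨U, hU⟩ := Ultrafilter.exists_le (𝓝[>] (0 : ℝ))
  have hU0 : (U : Filter ℝ) ≤ 𝓝 0 := hU.trans nhdsWithin_le_nhds
  have hslope : Tendsto (fun t => t⁻¹ • (c t - 1)) U (𝓝 w) := by
    have := hw.tendsto_slope.mono_left (hU.trans (nhdsWithin_mono _ fun t ht => ne_of_gt ht))
    refine this.congr fun t => ?_
    rw [slope_def_module, hc0, sub_zero]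
  have lim : ∀ {f : ℝ → Matrix n n ℝ} {K : Set (Matrix n n ℝ)}, IsCompact K → (∀ t, f t ∈ K) →
      ∃ a ∈ K, Tendsto f U (𝓝 a) := by
    intro f K hK hf
    exact hK.ultrafilter_le_nhds (U.map f) (le_principal_iff.mpr (Filter.mem_map.mpr (univ_mem' hf)))
  have hg1h1 : Tendsto g U (𝓝 1) ∧ Tendsto h U (𝓝 1) := by
    obtain ⟨a, ha, hga⟩ := lim hG.isCompact hg
    obtain ⟨b, hb, hhb⟩ := lim hH.isCompact hh
    have hab : a * star b = 1 := by
      refine tendsto_nhds_unique ((hga.mul hhb.star).congr fun t => (hgh t).symm) ?_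
      rw [← hc0]
      exact hw.continuousAt.tendsto.mono_left hU0
    have hab' : a = b := by
      have h1 : star b * b = 1 := (hH.2 b hb).1
      rw [← mul_one a, ← h1, ← mul_assoc, hab, one_mul]
    subst hab'
    have hsa : star a * a = 1 := (hG.2 a ha).1
    have hle : trace (a * star a) + trace (a * star a) ≤ trace a + trace a := by
      have ct : Continuous (trace : Matrix n n ℝ → ℝ) := continuous_id.matrix_trace
      refine le_of_tendsto_of_tendsto'
        (((ct.tendsto _).comp (hga.mul_const _)).add ((ct.tendsto _).comp (hhb.mul_const _)))
        (((ct.tendsto _).comp hga).add ((ct.tendsto _).comp hhb)) fun t => ?_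
      refine hmax t _ (hG.1.2.1 _ (hg t) _ (hG.1.2.2 _ ha)) _
        (hH.1.2.1 _ (hh t) _ (hH.1.2.2 _ hb)) ?_
      rw [star_mul, star_star, mul_assoc, ← mul_assoc (star a), hsa, one_mul]
      exact hgh t
    have ha1 : a = 1 := eq_one_of_trace_one_le (hG.2 a ha) (by rw [hab] at hle; linarith)
    subst ha1
    exact ⟨hga, hhb⟩
  obtain ⟨hg1, hh1⟩ := hg1h1
  set r : ℝ → ℝ := fun t => ‖g t - 1‖ + ‖h t - 1‖ with hrdef
  have hr0 : Tendsto r U (𝓝 0) := by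
    have := (hg1.sub_const 1).norm.add (hh1.sub_const 1).norm
    simpa using this
  have hrnn : ∀ t, 0 ≤ r t := fun t => by positivity
  rcases U.em (fun t => r t = 0) with hz | hnz
  · refine ⟨0, zero_mem _, 0, zero_mem _, ?_⟩
    rw [sub_zero]
    refine tendsto_nhds_unique (hslope.congr' ?_) tendsto_const_nhds
    filter_upwards [hz] with t ht
    have h1 : ‖g t - 1‖ = 0 := by
      have := norm_nonneg (g t - 1); have := norm_nonneg (h t - 1); simp only [hrdef] at ht; linarith
    have h2 : ‖h t - 1‖ = 0 := by
      have := norm_nonneg (g t - 1); have := norm_nonneg (h t - 1); simp only [hrdef] at ht; linarith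
    rw [hgh t, sub_eq_zero.mp (norm_eq_zero.mp h1), sub_eq_zero.mp (norm_eq_zero.mp h2)]
    simp
  have hr : ∀ᶠ t in (U : Filter ℝ), 0 < r t := hnz.mono fun t ht => lt_of_le_of_ne (hrnn t) (Ne.symm ht)
  have : ProperSpace (Matrix n n ℝ) := FiniteDimensional.proper ℝ _
  have bound : ∀ (x : Matrix n n ℝ) (ρ : ℝ), ‖x‖ ≤ ρ → ρ⁻¹ • x ∈ Metric.closedBall (0 : Matrix n n ℝ) 1 := by
    intro x ρ hx
    have hρ : 0 ≤ ρ := (norm_nonneg x).trans hx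
    rw [mem_closedBall_zero_iff, norm_smul, norm_inv, Real.norm_of_nonneg hρ]
    exact inv_mul_le_one_of_le₀ hx hρ
  obtain ⟨ξ, -, hξ⟩ := lim (isCompact_closedBall (0 : Matrix n n ℝ) 1) (f := fun t => (r t)⁻¹ • (g t - 1))
    fun t => bound _ _ (le_add_of_nonneg_right (norm_nonneg _))
  obtain ⟨η, -, hη⟩ := lim (isCompact_closedBall (0 : Matrix n n ℝ) 1) (f := fun t => (r t)⁻¹ • (h t - 1))
    fun t => bound _ _ (le_add_of_nonneg_left (norm_nonneg _))
  have hξs : ξ ∈ skewMat n :=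
    mem_skewMat_of_tendsto (Eventually.of_forall fun t => hG.2 _ (hg t)) hr hr0 hξ
  have hηs : η ∈ skewMat n :=
    mem_skewMat_of_tendsto (Eventually.of_forall fun t => hH.2 _ (hh t)) hr hr0 hη
  have hξG : ξ ∈ hG.lieSub :=
    ⟨hξs, hG.exp_smul_mem_of_tendsto (Eventually.of_forall hg) hr hr0 hξ⟩
  have hηH : η ∈ hH.lieSub :=
    ⟨hηs, hH.exp_smul_mem_of_tendsto (Eventually.of_forall hh) hr hr0 hη⟩
  have hstar : star η = -η := by
    rw [star_eq_conjTranspose, conjTranspose_eq_transpose_of_trivial]; exact hηs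
  have hnorm : ‖ξ‖ + ‖η‖ = 1 := by
    refine tendsto_nhds_unique (hξ.norm.add hη.norm) (tendsto_const_nhds.congr' ?_)
    filter_upwards [hr] with t ht
    rw [norm_smul, norm_smul, ← mul_add, norm_inv, Real.norm_of_nonneg ht.le]
    exact (inv_mul_cancel₀ ht.ne').symm
  have hu : Tendsto (fun t => (r t)⁻¹ • (c t - 1)) U (𝓝 (ξ - η)) := by
    have h1 : Tendsto (fun t => (r t)⁻¹ • (g t - 1) * star (h t) + star ((r t)⁻¹ • (h t - 1))) U
        (𝓝 (ξ * star 1 + star η)) := (hξ.mul hh1.star).add hη.star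
    rw [star_one, mul_one, hstar, ← sub_eq_add_neg] at h1
    refine h1.congr fun t => ?_
    rw [hgh t]
    simp only [star_smul, star_sub, star_one, star_trivial, smul_mul_assoc, sub_mul, one_mul]
    module
  by_cases hne : ξ - η = 0
  · exfalso
    obtain rfl : ξ = η := sub_eq_zero.mp hne
    have hcrit : ∀ t, trace (g t * ξ) + trace (h t * ξ) = 0 := fun t =>
      trace_mul_eq_zero_of_isLocalMax fun s => by
        refine hmax t _ (hG.1.2.1 _ (hg t) _ (hξG.2 s)) _ (hH.1.2.1 _ (hh t) _ (hηH.2 s)) ?_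
        have : exp (s • ξ) * star (exp (s • ξ)) = 1 := (exp_smul_mem_unitary hξs s).2
        rw [star_mul, mul_assoc, ← mul_assoc (exp (s • ξ)), this, one_mul]
        exact hgh t
    have htr : trace ξ = 0 := by
      have := congrArg trace (mem_skewMat.mp hξs)
      rw [trace_transpose, trace_neg] at this
      linarith
    have ct : Continuous (trace : Matrix n n ℝ → ℝ) := continuous_id.matrix_trace
    have h1 : Tendsto (fun t => trace ((r t)⁻¹ • (g t - 1) * ξ) + trace ((r t)⁻¹ • (h t - 1) * ξ)) U
        (𝓝 (trace (ξ * ξ) + trace (ξ * ξ))) :=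
      ((ct.tendsto _).comp (hξ.mul_const _)).add ((ct.tendsto _).comp (hη.mul_const _))
    have h2 : trace (ξ * ξ) + trace (ξ * ξ) = 0 := by
      refine tendsto_nhds_unique h1 (tendsto_const_nhds.congr fun t => ?_)
      simp only [smul_mul_assoc, trace_smul, sub_mul, one_mul, trace_sub, htr, sub_zero,
        smul_eq_mul, ← mul_add, hcrit t, mul_zero]
    have h3 : ξ = 0 := by
      apply frob_self_eq_zero
      rw [frob_apply, mem_skewMat.mp hξs, neg_mul, trace_neg]
      linarith
    rw [h3] at hnorm
    simp at hnorm
  · have hpos : ‖ξ - η‖ ≠ 0 := norm_ne_zero_iff.mpr hne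
    have hrt : Tendsto (fun t => t⁻¹ * r t) U (𝓝 (‖w‖ / ‖ξ - η‖)) := by
      refine (hslope.norm.div hu.norm hpos).congr' ?_
      have htpos : ∀ᶠ t in (U : Filter ℝ), 0 < t := hU self_mem_nhdsWithin
      have hcne : ∀ᶠ t in (U : Filter ℝ), (r t)⁻¹ • (c t - 1) ≠ 0 := hu.eventually_ne hne
      filter_upwards [hr, htpos, hcne] with t h1 h2 h3
      have h4 : ‖c t - 1‖ ≠ 0 := norm_ne_zero_iff.mpr fun h => h3 (by rw [h, smul_zero])
      rw [Pi.div_apply, norm_smul, norm_smul, norm_inv, norm_inv, Real.norm_of_nonneg h1.le,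
        Real.norm_of_nonneg h2.le]
      field_simp
    refine ⟨_, hG.lieSub.smul_mem (‖w‖ / ‖ξ - η‖) hξG, _, hH.lieSub.smul_mem (‖w‖ / ‖ξ - η‖) hηH, ?_⟩
    rw [← smul_sub]
    refine tendsto_nhds_unique hslope ((hrt.smul hu).congr' ?_)
    filter_upwards [hr] with t ht
    rw [smul_smul, mul_assoc, mul_inv_cancel₀ ht.ne', mul_one]

end Orbit

end

section

open Matrix

section TraceCriterion

variable {n : Type*} [Fintype n] [DecidableEq n]

theorem exists_mulVec_eq_neg {B : Matrix n n ℝ} (h2 : B * B = 1) (h1 : B ≠ 1) :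
    ∃ u : n → ℝ, u ≠ 0 ∧ B *ᵥ u = -u := by
  by_contra! hcon
  refine h1 (Matrix.mulVec_injective (funext fun v => ?_))
  by_contra hne
  refine hcon (B *ᵥ v - v) (fun h => hne (by rw [one_mulVec]; exact sub_eq_zero.mp h)) ?_
  rw [mulVec_sub, mulVec_mulVec, h2, one_mulVec, neg_sub]

/-- The only rotation at which the trace function has vanishing first and nonpositive second
variation along all one-parameter groups of rotations is the identity. -/
theorem eq_one_of_forall_trace_skew {B : Matrix n n ℝ} (hB : Bᵀ * B = 1) (hdet : B.det = 1)
    (htr : ∀ X ∈ skewMat n, trace (X * B) = 0) (htr2 : ∀ X ∈ skewMat n, trace (X * X * B) ≤ 0) :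
    B = 1 := by
  have hsymm : Bᵀ = B := by
    have hX : B - Bᵀ ∈ skewMat n := by
      rw [mem_skewMat, transpose_sub, transpose_transpose, neg_sub]
    have h1 := htr _ hX
    have h2 : trace ((B - Bᵀ) * Bᵀ) = -trace ((B - Bᵀ) * B) := by
      rw [← trace_transpose ((B - Bᵀ) * B), transpose_mul, mem_skewMat.mp hX, mul_neg, trace_neg,
        neg_neg, trace_mul_comm]
    have h3 : B - Bᵀ = 0 := by
      apply frob_self_eq_zero
      rw [frob_apply, mem_skewMat.mp hX, neg_mul, mul_sub, trace_neg, trace_sub, h2, h1]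
      simp
    exact (sub_eq_zero.mp h3).symm
  rw [hsymm] at hB
  by_contra hne
  obtain ⟨u, hu0, hu⟩ := exists_mulVec_eq_neg hB hne
  have huB : u ᵥ* B = -u := by rw [← hsymm, vecMul_transpose, hu]
  have huu : 0 < u ⬝ᵥ u := by
    have := dotProduct_star_self_pos_iff.mpr hu0
    simpa using this
  set c : ℝ := 2 / (u ⬝ᵥ u) with hc
  have hcu : c * (u ⬝ᵥ u) = 2 := by rw [hc]; field_simp
  set B' : Matrix n n ℝ := B + c • vecMulVec u u with hB'
  have hB's : B'ᵀ = B' := by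
    rw [hB', transpose_add, transpose_smul, transpose_vecMulVec, hsymm]
  have hB'2 : B' * B' = 1 := by
    rw [hB']
    have e1 : vecMulVec u u * vecMulVec u u = (u ⬝ᵥ u) • vecMulVec u u := by
      rw [vecMulVec_mul_vecMulVec, vecMulVec_smul]
    have e2 : B * vecMulVec u u = -vecMulVec u u := by rw [mul_vecMulVec, hu, neg_vecMulVec]
    have e3 : vecMulVec u u * B = -vecMulVec u u := by rw [vecMulVec_mul, huB, vecMulVec_neg]
    simp only [add_mul, mul_add, hB, smul_mul_assoc, mul_smul_comm, e1, e2, e3]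
    have : c * (c * (u ⬝ᵥ u)) = 2 * c := by rw [hcu]; ring
    match_scalars <;> linarith
  have hdet' : B'.det = -1 := by
    have h1 : B' = (1 + replicateCol Unit ((-c) • u) * replicateRow Unit u) * B := by
      rw [← vecMulVec_eq, add_mul, one_mul, vecMulVec_mul, huB, smul_vecMulVec, vecMulVec_neg, hB']
      module
    rw [h1, det_mul, hdet, det_one_add_replicateCol_mul_replicateRow, dotProduct_smul, smul_eq_mul]
    linarith
  have hne' : B' ≠ 1 := fun h => by rw [h, det_one] at hdet'; norm_num at hdet'
  obtain ⟨v, hv0, hv⟩ := exists_mulVec_eq_neg hB'2 hne'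
  have hvv : 0 < v ⬝ᵥ v := by
    have := dotProduct_star_self_pos_iff.mpr hv0
    simpa using this
  have hB'u : u ᵥ* B' = u := by
    rw [hB', vecMul_add, vecMul_smul, vecMul_vecMulVec, huB, smul_smul, hcu]
    module
  have huv : u ⬝ᵥ v = 0 := by
    have : (u ᵥ* B') ⬝ᵥ v = u ⬝ᵥ (B' *ᵥ v) := (dotProduct_mulVec _ _ _).symm
    rw [hB'u, hv, dotProduct_neg] at this
    linarith
  have hvu : v ⬝ᵥ u = 0 := by rw [dotProduct_comm, huv]
  have hBv : v ᵥ* B = -v := by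
    rw [← hsymm, vecMul_transpose, ← hv, hB', add_mulVec, smul_mulVec, vecMulVec_mulVec, huv]
    simp
  have hX : vecMulVec u v - vecMulVec v u ∈ skewMat n := by
    rw [mem_skewMat, transpose_sub, transpose_vecMulVec, transpose_vecMulVec, neg_sub]
  have := htr2 _ hX
  simp only [sub_mul, mul_sub, vecMulVec_mul, trace_sub, trace_vecMulVec, vecMul_vecMulVec,
    huv, hvu, zero_smul, smul_vecMul, huB, hBv, dotProduct_smul, dotProduct_neg, smul_eq_mul,
    zero_vecMul, dotProduct_zero] at this
  nlinarith [mul_pos huu hvv]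

end TraceCriterion

section MaximalTrace

open Filter Topology
open scoped Matrix.Norms.L2Operator
open NormedSpace (exp)

variable {n : Type*} [Fintype n] [DecidableEq n]

theorem trace_mul_eq_zero_of_trace_exp_mul_le {X B : Matrix n n ℝ}
    (h : ∀ s : ℝ, trace (exp (s • X) * B) ≤ trace B) : trace (X * B) = 0 := by
  have := trace_mul_eq_zero_of_isLocalMax (A := B) (B := 0) (ξ := X) fun s => by
    simpa [trace_mul_comm B] using h s
  simpa [trace_mul_comm B] using this

theorem trace_sq_mul_nonpos_of_trace_exp_mul_le {X B : Matrix n n ℝ}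
    (h : ∀ s : ℝ, trace (exp (s • X) * B) ≤ trace B) : trace (X * X * B) ≤ 0 := by
  have hd : HasDerivAt (fun s : ℝ => exp (s • X) - exp (s • (-X))) (X - -X) 0 := by
    have h1 := hasDerivAt_exp_smul X 0
    have h2 := hasDerivAt_exp_smul (-X) 0
    simp only [zero_smul, NormedSpace.exp_zero, one_mul] at h1 h2
    exact h1.sub h2
  have hs : Tendsto (fun s : ℝ => s⁻¹ • (exp (s • X) - exp (s • (-X)))) (𝓝[≠] 0) (𝓝 (X - -X)) := by
    refine hd.tendsto_slope.congr fun s => ?_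
    simp [slope_def_module]
  have ct : Continuous (trace : Matrix n n ℝ → ℝ) := continuous_id.matrix_trace
  have hl := (ct.tendsto _).comp ((hs.mul hs).mul_const B)
  have hle : trace ((X - -X) * (X - -X) * B) ≤ 0 := by
    refine le_of_tendsto hl (Eventually.of_forall fun s => ?_)
    have e1 : exp (s • X) * exp (s • X) = exp ((s + s) • X) := (exp_add_smul_mat X s s).symm
    have e2 : exp (s • (-X)) * exp (s • (-X)) = exp ((-s + -s) • X) := by
      rw [exp_add_smul_mat, smul_neg, neg_smul]
    have e3 : exp (s • X) * exp (s • (-X)) = 1 := by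
      rw [smul_neg, ← neg_smul, ← exp_add_smul_mat]; simp
    have e4 : exp (s • (-X)) * exp (s • X) = 1 := by
      rw [smul_neg, ← neg_smul, ← exp_add_smul_mat]; simp
    have h1 := h (s + s)
    have h2 := h (-s + -s)
    have e5 : (exp (s • X) - exp (s • (-X))) * (exp (s • X) - exp (s • (-X)))
        = exp ((s + s) • X) + exp ((-s + -s) • X) - (2 : ℝ) • 1 := by
      rw [sub_mul, mul_sub, mul_sub, e1, e2, e3, e4]
      module
    simp only [Function.comp_apply, smul_mul_assoc, mul_smul_comm, e5]
    simp only [sub_mul, add_mul, smul_mul_assoc,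
      trace_smul, trace_sub, trace_add, one_mul, smul_eq_mul]
    rw [← mul_assoc]
    exact mul_nonpos_of_nonneg_of_nonpos (mul_self_nonneg _) (by linarith)
  have : (X - -X) * (X - -X) * B = (4 : ℝ) • (X * X * B) := by
    rw [sub_neg_eq_add, ← two_smul ℝ X, smul_mul_assoc, mul_smul_comm, smul_smul, smul_mul_assoc]
    norm_num
  rw [this, trace_smul, smul_eq_mul] at hle
  linarith

end MaximalTrace

end

section

open Matrix

section SOPair

open Filter Topology
open scoped Matrix.Norms.L2Operator
open NormedSpace (exp)

variable {p q : ℕ}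

theorem trace_fromBlocks_eq {m n : Type*} [Fintype m] [Fintype n] (a : Matrix m m ℝ)
    (b : Matrix m n ℝ) (c : Matrix n m ℝ) (d : Matrix n n ℝ) :
    trace (fromBlocks a b c d) = trace a + trace d := by
  simp [trace]

theorem mem_SOPairSet_iff {A : Matrix (Fin p ⊕ Fin q) (Fin p ⊕ Fin q) ℝ} :
    A ∈ SOPairSet p q ↔ ∃ a d, A = fromBlocks a 0 0 d ∧ aᵀ * a = 1 ∧ dᵀ * d = 1 ∧
      a.det = 1 ∧ d.det = 1 := by
  constructor
  · rintro ⟨h1, -, h2, h3, h4⟩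
    have hA : A = fromBlocks A.toBlocks₁₁ 0 0 A.toBlocks₂₂ := by
      ext (i | i) (j | j)
      · rfl
      · exact (h2 i j).1
      · exact (h2 j i).2
      · rfl
    refine ⟨_, _, hA, ?_, ?_, h3, h4⟩ <;>
    · rw [hA, star_eq_conjTranspose, conjTranspose_eq_transpose_of_trivial, fromBlocks_transpose,
        fromBlocks_multiply, ← fromBlocks_one, fromBlocks_inj] at h1
      simp only [transpose_zero, Matrix.mul_zero, add_zero, zero_add] at h1
      first | exact h1.1 | exact h1.2.2.2
  · rintro ⟨a, d, rfl, ha, hd, ha1, hd1⟩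
    refine ⟨?_, ?_, fun i j => ⟨rfl, rfl⟩, ?_, ?_⟩
    · rw [star_eq_conjTranspose, conjTranspose_eq_transpose_of_trivial, fromBlocks_transpose,
        fromBlocks_multiply]
      simp [ha, hd]
    · rw [star_eq_conjTranspose, conjTranspose_eq_transpose_of_trivial, fromBlocks_transpose,
        fromBlocks_multiply]
      simp [mul_eq_one_comm.mp ha, mul_eq_one_comm.mp hd]
    · rwa [toBlocks_fromBlocks₁₁]
    · rwa [toBlocks_fromBlocks₂₂]

theorem mem_unitary_of_mem_SOPairSet {A : Matrix (Fin p ⊕ Fin q) (Fin p ⊕ Fin q) ℝ}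
    (hA : A ∈ SOPairSet p q) : A ∈ unitary (Matrix (Fin p ⊕ Fin q) (Fin p ⊕ Fin q) ℝ) :=
  ⟨hA.1, hA.2.1⟩

theorem mul_mem_SOPairSet {A B : Matrix (Fin p ⊕ Fin q) (Fin p ⊕ Fin q) ℝ}
    (hA : A ∈ SOPairSet p q) (hB : B ∈ SOPairSet p q) : A * B ∈ SOPairSet p q := by
  rw [mem_SOPairSet_iff] at *
  obtain ⟨a, d, rfl, ha, hd, ha1, hd1⟩ := hA
  obtain ⟨b, e, rfl, hb, he, hb1, he1⟩ := hB
  refine ⟨a * b, d * e, by simp [fromBlocks_multiply], ?_, ?_, by simp [ha1, hb1],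
    by simp [hd1, he1]⟩
  · rw [transpose_mul, mul_assoc, ← mul_assoc aᵀ, ha, one_mul, hb]
  · rw [transpose_mul, mul_assoc, ← mul_assoc dᵀ, hd, one_mul, he]

theorem star_mem_SOPairSet {A : Matrix (Fin p ⊕ Fin q) (Fin p ⊕ Fin q) ℝ}
    (hA : A ∈ SOPairSet p q) : star A ∈ SOPairSet p q := by
  rw [mem_SOPairSet_iff] at *
  obtain ⟨a, d, rfl, ha, hd, ha1, hd1⟩ := hA
  refine ⟨aᵀ, dᵀ, ?_, ?_, ?_, by simpa using ha1, by simpa using hd1⟩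
  · rw [star_eq_conjTranspose, conjTranspose_eq_transpose_of_trivial, fromBlocks_transpose]
    simp
  · rw [transpose_transpose]; exact mul_eq_one_comm.mp ha
  · rw [transpose_transpose]; exact mul_eq_one_comm.mp hd

theorem exp_smul_mem_SOPairSet {X : Matrix (Fin p ⊕ Fin q) (Fin p ⊕ Fin q) ℝ}
    (hX : X ∈ blockSkew (Fin p) (Fin q)) (s : ℝ) : exp (s • X) ∈ SOPairSet p q := by
  set P : Matrix (Fin p ⊕ Fin q) (Fin p ⊕ Fin q) ℝ := fromBlocks 1 0 0 0 with hP
  set E := exp ((s / 2) • X) with hE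
  have hEE : exp (s • X) = E * E := by rw [hE, ← exp_add_smul_mat, add_halves]
  have hEu : E ∈ unitary _ := exp_smul_mem_unitary (blockSkew_le hX) _
  have hcomm : E * P = P * E := by
    have h1 : Commute X P := by
      obtain ⟨a, -, d, -, rfl⟩ := exists_fromBlocks_of_mem hX
      simp [Commute, SemiconjBy, hP, fromBlocks_multiply]
    exact (h1.smul_left (s / 2)).exp_left.eq
  rw [← fromBlocks_toBlocks E, hP, fromBlocks_multiply, fromBlocks_multiply, fromBlocks_inj] at hcomm
  simp only [Matrix.mul_zero, add_zero, Matrix.one_mul, Matrix.zero_mul, Matrix.mul_one, true_and,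
    and_true] at hcomm
  have hEb : E = fromBlocks E.toBlocks₁₁ 0 0 E.toBlocks₂₂ := by
    conv_lhs => rw [← fromBlocks_toBlocks E]
    rw [hcomm.2, ← hcomm.1]
  have h1 := hEu.1
  rw [hEb, star_eq_conjTranspose, conjTranspose_eq_transpose_of_trivial, fromBlocks_transpose,
    fromBlocks_multiply, ← fromBlocks_one, fromBlocks_inj] at h1
  simp only [transpose_zero, Matrix.mul_zero, add_zero, zero_add] at h1
  have key : ∀ {m : ℕ} (a : Matrix (Fin m) (Fin m) ℝ), aᵀ * a = 1 →
      (a * a)ᵀ * (a * a) = 1 ∧ (a * a).det = 1 := by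
    intro m a ha
    refine ⟨?_, ?_⟩
    · rw [transpose_mul, mul_assoc, ← mul_assoc aᵀ a, ha, one_mul, ha]
    · have := congrArg det ha
      rwa [det_mul, det_transpose, ← det_mul, det_one] at this
  rw [mem_SOPairSet_iff]
  refine ⟨_, _, ?_, (key _ h1.1).1, (key _ h1.2.2.2).1, (key _ h1.1).2, (key _ h1.2.2.2).2⟩
  rw [hEE, hEb, fromBlocks_multiply]
  simp

theorem SOPairSet_subset_of_blockSkew_le {G : Set (Matrix (Fin p ⊕ Fin q) (Fin p ⊕ Fin q) ℝ)}
    (hG : IsClosedOrthGroup G) (hGK : G ⊆ SOPairSet p q)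
    (h : blockSkew (Fin p) (Fin q) ≤ hG.lieSub) : SOPairSet p q ⊆ G := by
  intro A hA
  obtain ⟨g, hg, hmax⟩ := hG.isCompact.exists_isMaxOn ⟨1, hG.1.1⟩ (f := fun g => trace (g * A))
    (continuous_id.matrix_mul continuous_const).matrix_trace.continuousOn
  have hB : g * A ∈ SOPairSet p q := mul_mem_SOPairSet (hGK hg) hA
  have hX : ∀ X ∈ blockSkew (Fin p) (Fin q), ∀ s : ℝ,
      trace (exp (s • X) * (g * A)) ≤ trace (g * A) := fun X hX s => by
    rw [← mul_assoc]
    exact hmax (a := exp (s • X) * g) (hG.1.2.1 _ ((h hX).2 s) _ hg)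
  have h1 : ∀ X ∈ blockSkew (Fin p) (Fin q), trace (X * (g * A)) = 0 := fun X h =>
    trace_mul_eq_zero_of_trace_exp_mul_le (hX X h)
  have h2 : ∀ X ∈ blockSkew (Fin p) (Fin q), trace (X * X * (g * A)) ≤ 0 := fun X h =>
    trace_sq_mul_nonpos_of_trace_exp_mul_le (hX X h)
  obtain ⟨b, d, hbd, hb, hd, hb1, hd1⟩ := mem_SOPairSet_iff.mp hB
  rw [hbd] at h1 h2
  have hb' : b = 1 := by
    refine eq_one_of_forall_trace_skew hb hb1 (fun X hX => ?_) fun X hX => ?_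
    · simpa [fromBlocks_multiply, trace_fromBlocks_eq] using
        h1 _ (fromBlocks_mem_blockSkew hX (zero_mem _))
    · simpa [fromBlocks_multiply, trace_fromBlocks_eq] using
        h2 _ (fromBlocks_mem_blockSkew hX (zero_mem _))
  have hd' : d = 1 := by
    refine eq_one_of_forall_trace_skew hd hd1 (fun X hX => ?_) fun X hX => ?_
    · simpa [fromBlocks_multiply, trace_fromBlocks_eq] using
        h1 _ (fromBlocks_mem_blockSkew (zero_mem _) hX)
    · simpa [fromBlocks_multiply, trace_fromBlocks_eq] using
        h2 _ (fromBlocks_mem_blockSkew (zero_mem _) hX)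
  have hgA : g * A = 1 := by rw [hbd, hb', hd', fromBlocks_one]
  have : A = star g := by rw [← one_mul A, ← (hG.2 g hg).1, mul_assoc, hgA, mul_one]
  rw [this]
  exact hG.1.2.2 g hg

end SOPair

end

section

open Matrix

section TangentSpaces

open Filter Topology
open scoped Matrix.Norms.L2Operator
open NormedSpace (exp)

variable {n : Type*} [Fintype n] [DecidableEq n]

theorem hasDerivAt_matrix_iff {c : ℝ → Matrix n n ℝ} {w : Matrix n n ℝ} {t : ℝ} :
    HasDerivAt c w t ↔ ∀ i j, HasDerivAt (fun s => c s i j) (w i j) t := by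
  refine ⟨fun h i j => (LinearMap.toContinuousLinearMap
    (entryLinearMap ℝ ℝ i j)).hasFDerivAt.comp_hasDerivAt t h, fun h => ?_⟩
  have h1 : ∀ A : Matrix n n ℝ, A = ∑ i, ∑ j, A i j • single i j (1 : ℝ) := fun A => by
    conv_lhs => rw [matrix_eq_sum_single A]
    simp
  rw [h1 w, funext fun s => h1 (c s)]
  exact HasDerivAt.fun_sum fun i _ => HasDerivAt.fun_sum fun j _ => (h i j).smul_const _

theorem mem_matTangentAt_of_exp_smul_mem {S : Set (Matrix n n ℝ)} {X : Matrix n n ℝ}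
    (h : ∀ s : ℝ, exp (s • X) ∈ S) : X ∈ matTangentAt S 1 := by
  refine Submodule.subset_span ⟨fun s => exp (s • X), h, by simp, hasDerivAt_matrix_iff.mp ?_⟩
  have := hasDerivAt_exp_smul X 0
  simpa only [zero_smul, NormedSpace.exp_zero, one_mul] using this

/-- The conjugate of a closed group of orthogonal matrices by an orthogonal matrix. -/
theorem IsClosedOrthGroup.conj {G : Set (Matrix n n ℝ)} (hG : IsClosedOrthGroup G)
    {k : Matrix n n ℝ} (hk : k ∈ unitary (Matrix n n ℝ)) :
    IsClosedOrthGroup {a : Matrix n n ℝ | k * a * star k ∈ G} := by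
  have h1 : star k * k = 1 := hk.1
  have h2 : k * star k = 1 := hk.2
  refine ⟨⟨?_, fun a ha b hb => ?_, fun a ha => ?_⟩, fun a ha => ?_, ?_⟩
  · simpa [h2] using hG.1.1
  · have := hG.1.2.1 _ ha _ hb
    rw [Set.mem_ofPred_eq]
    convert! this using 1
    calc k * (a * b) * star k = k * a * 1 * b * star k := by noncomm_ring
      _ = _ := by rw [← h1]; noncomm_ring
  · have := hG.1.2.2 _ ha
    rwa [star_mul, star_mul, star_star, ← mul_assoc] at this
  · have h3 : a = star k * (k * a * star k) * k := by
      calc a = 1 * a * 1 := by simp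
        _ = _ := by rw [← h1]; noncomm_ring
    rw [h3]
    exact mul_mem (mul_mem (Unitary.star_mem hk) (hG.2 _ ha)) hk
  · exact hG.isClosed.preimage ((continuous_const.matrix_mul continuous_id).matrix_mul
      continuous_const)

theorem star_mul_mem_of_mem_matTangentAt_lrOrbit {G H : Set (Matrix n n ℝ)}
    {k : Matrix n n ℝ} (hk : k ∈ unitary (Matrix n n ℝ))
    (hG : IsClosedOrthGroup {a : Matrix n n ℝ | k * a * star k ∈ G}) (hH : IsClosedOrthGroup H)
    {w : Matrix n n ℝ} (hw : w ∈ matTangentAt (lrOrbit G H k) k) :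
    star k * w ∈ hG.lieSub ⊔ hH.lieSub := by
  have h1 : star k * k = 1 := hk.1
  have h2 : k * star k = 1 := hk.2
  suffices h : matTangentAt (lrOrbit G H k) k ≤
      (hG.lieSub ⊔ hH.lieSub).comap (LinearMap.mulLeft ℝ (star k)) from h hw
  refine Submodule.span_le.mpr ?_
  rintro v ⟨c, hc, hc0, hv⟩
  have hd : HasDerivAt (fun t => star k * c t) (star k * v) 0 :=
    (hasDerivAt_matrix_iff.mpr hv).const_mul (star k)
  obtain ⟨X, hX, Z, hZ, hXZ⟩ := exists_lieSub_sub_of_hasDerivAt hG hH (fun t => by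
    obtain ⟨g, hg, h, hh, hgh⟩ := hc t
    refine ⟨star k * g * k, ?_, h, hh, ?_⟩
    · rw [Set.mem_ofPred_eq]
      convert! hg using 1
      calc _ = (k * star k) * g * (k * star k) := by noncomm_ring
        _ = g := by rw [h2, one_mul, mul_one]
    · rw [hgh]; noncomm_ring) (by simp only [hc0, h1]) hd
  change star k * v ∈ hG.lieSub ⊔ hH.lieSub
  rw [hXZ]
  exact sub_mem (Submodule.mem_sup_left hX) (Submodule.mem_sup_right hZ)

theorem finrank_matTangentAt_lrOrbit_le {G H : Set (Matrix n n ℝ)}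
    {k : Matrix n n ℝ} (hk : k ∈ unitary (Matrix n n ℝ))
    (hG : IsClosedOrthGroup {a : Matrix n n ℝ | k * a * star k ∈ G}) (hH : IsClosedOrthGroup H) :
    finrank ℝ (matTangentAt (lrOrbit G H k) k) ≤
      finrank ℝ (hG.lieSub ⊔ hH.lieSub : Submodule ℝ (Matrix n n ℝ)) := by
  refine LinearMap.finrank_le_finrank_of_injective (f := ((LinearMap.mulLeft ℝ (star k)).restrict
    fun w hw => star_mul_mem_of_mem_matTangentAt_lrOrbit hk hG hH hw)) fun x y hxy => ?_
  have h : star k * (x : Matrix n n ℝ) = star k * y := congrArg Subtype.val hxy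
  have h' := congrArg (k * ·) h
  simp only [← mul_assoc, hk.2, one_mul] at h'
  exact Subtype.ext h'

/-- The group of orthogonal matrices fixing the basis vectors indexed by a set. -/
def fixingGroup (F : Set n) : Set (Matrix n n ℝ) :=
  {A | A ∈ unitary (Matrix n n ℝ) ∧ ∀ j ∈ F, A *ᵥ Pi.single j 1 = Pi.single j 1}

theorem isClosedOrthGroup_fixingGroup (F : Set n) : IsClosedOrthGroup (fixingGroup F) := by
  refine ⟨⟨⟨one_mem _, fun j _ => one_mulVec _⟩, fun a ha b hb => ⟨mul_mem ha.1 hb.1, fun j hj => ?_⟩,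
    fun a ha => ⟨Unitary.star_mem ha.1, fun j hj => ?_⟩⟩, fun a ha => ha.1, ?_⟩
  · rw [← mulVec_mulVec, hb.2 j hj, ha.2 j hj]
  · have h1 : star a * a = 1 := ha.1.1
    conv_lhs => rw [← ha.2 j hj]
    rw [mulVec_mulVec, h1, one_mulVec]
  · have h1 : IsClosed {A : Matrix n n ℝ | star A * A = 1 ∧ A * star A = 1} :=
      (isClosed_eq (continuous_id.star.mul continuous_id) continuous_const).inter
        (isClosed_eq (continuous_id.mul continuous_id.star) continuous_const)
    have h2 : IsClosed {A : Matrix n n ℝ | ∀ j ∈ F,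
        A *ᵥ Pi.single j (1 : ℝ) = Pi.single j (1 : ℝ)} := by
      simp only [Set.ofPred_forall]
      exact isClosed_iInter fun j => isClosed_iInter fun _ =>
        isClosed_eq (continuous_id.matrix_mulVec continuous_const) continuous_const
    exact h1.inter h2

theorem apply_eq_zero_of_mem_lieSub_fixingGroup {F : Set n} {X : Matrix n n ℝ}
    (hX : X ∈ (isClosedOrthGroup_fixingGroup F).lieSub) {j : n} (hj : j ∈ F) (i : n) :
    X i j = 0 ∧ X j i = 0 := by
  have h1 : HasDerivAt (fun s : ℝ => exp (s • X)) X 0 := by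
    have := hasDerivAt_exp_smul X 0
    simpa only [zero_smul, NormedSpace.exp_zero, one_mul] using this
  have h2 : X i j = 0 := by
    refine (hasDerivAt_matrix_iff.mp h1 i j).unique ?_
    have : (fun s : ℝ => exp (s • X) i j) = fun _ => (Pi.single j (1 : ℝ) : n → ℝ) i := by
      funext s
      have := congrFun ((hX.2 s).2 j hj) i
      rwa [mulVec_single_one] at this
    rw [this]
    exact hasDerivAt_const _ _
  exact ⟨h2, by rw [skewMat_apply hX.1, h2, neg_zero]⟩

end TangentSpaces

end

section

open Matrix

section Cohomogeneity

theorem matTangentAt_mono {m m' : Type*} {S T : Set (Matrix m m' ℝ)} (h : S ⊆ T)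
    (x : Matrix m m' ℝ) :
    matTangentAt S x ≤ matTangentAt T x :=
  Submodule.span_mono fun _ ⟨c, hc, h0, hd⟩ => ⟨c, fun t => h (hc t), h0, hd⟩

variable {n : Type*} [Fintype n]

theorem exists_eq_smul_of_finrank_le {S T : Submodule ℝ (Matrix n n ℝ)} (hST : S ≤ T)
    (h : finrank ℝ T ≤ finrank ℝ S + 1) {Y Y' : Matrix n n ℝ} (hY : Y ∈ T) (hY' : Y' ∈ T)
    (hSY : ∀ X ∈ S, frob n X Y = 0) (hSY' : ∀ X ∈ S, frob n X Y' = 0) (hne : Y ≠ 0) :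
    ∃ c : ℝ, Y' = c • Y := by
  set P : Submodule ℝ (Matrix n n ℝ) := Submodule.span ℝ {Y, Y'} with hP
  have hPS : ∀ X ∈ S, ∀ Z ∈ P, frob n X Z = 0 := by
    intro X hX Z hZ
    obtain ⟨a, b, rfl⟩ := Submodule.mem_span_pair.mp hZ
    rw [map_add, map_smul, map_smul, hSY X hX, hSY' X hX]
    simp
  have hinf : S ⊓ P = ⊥ := by
    refine (Submodule.eq_bot_iff _).mpr fun Z hZ => frob_self_eq_zero (hPS Z hZ.1 Z hZ.2)
  have hsup : S ⊔ P ≤ T := sup_le hST (Submodule.span_le.mpr (by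
    rintro x (rfl | rfl)
    exacts [hY, hY']))
  have h1 := Submodule.finrank_sup_add_finrank_inf_eq S P
  rw [hinf, finrank_bot, add_zero] at h1
  have h2 := Submodule.finrank_mono hsup
  have h3 : Submodule.span ℝ {Y} = P := by
    refine Submodule.eq_of_le_of_finrank_le (Submodule.span_mono (by simp)) ?_
    rw [finrank_span_singleton hne]
    lia
  have h4 : Y' ∈ Submodule.span ℝ {Y} := h3 ▸ Submodule.subset_span (by simp)
  obtain ⟨c, hc⟩ := Submodule.mem_span_singleton.mp h4
  exact ⟨c, hc.symm⟩

variable {p q : ℕ}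

theorem exists_finrank_le_of_lrCohomogeneity_le_one
    {G H : Set (Matrix (Fin p ⊕ Fin q) (Fin p ⊕ Fin q) ℝ)}
    (h : lrCohomogeneity G H (SOPairSet p q) ≤ 1) :
    ∃ k ∈ SOPairSet p q, finrank ℝ (blockSkew (Fin p) (Fin q)) ≤
      finrank ℝ (matTangentAt (lrOrbit G H k) k) + 1 := by
  have h1 : (1 : Matrix (Fin p ⊕ Fin q) (Fin p ⊕ Fin q) ℝ) ∈ SOPairSet p q :=
    mem_SOPairSet_iff.mpr ⟨1, 1, fromBlocks_one.symm, by simp, by simp, by simp, by simp⟩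
  have hK : finrank ℝ (blockSkew (Fin p) (Fin q)) ≤ grpDim (SOPairSet p q) :=
    Submodule.finrank_mono fun X hX =>
      mem_matTangentAt_of_exp_smul_mem (exp_smul_mem_SOPairSet hX)
  have : Nonempty (SOPairSet p q) := ⟨1, h1⟩
  have hbdd : BddAbove (Set.range fun k : SOPairSet p q =>
      finrank ℝ (matTangentAt (lrOrbit G H k) (k : Matrix (Fin p ⊕ Fin q) (Fin p ⊕ Fin q) ℝ))) :=
    ⟨finrank ℝ (Matrix (Fin p ⊕ Fin q) (Fin p ⊕ Fin q) ℝ), by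
      rintro _ ⟨k, rfl⟩
      exact Submodule.finrank_le _⟩
  obtain ⟨k, hk⟩ := Nat.sSup_mem (Set.range_nonempty _) hbdd
  refine ⟨k, k.2, ?_⟩
  unfold lrCohomogeneity iSup at h
  rw [← hk] at h
  simp only at h
  lia

/-- The indices of the coordinates fixed by the principal isotropy group. -/
def fixedIndices (p q : ℕ) : Set (Fin p ⊕ Fin q) :=
  {x | ∀ i : Fin p, x = Sum.inl i → (i : ℕ) < q}

theorem SOPrincipalIsotropy_subset_fixingGroup :
    SOPrincipalIsotropy p q ⊆ fixingGroup (fixedIndices p q) := by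
  rintro A ⟨hA, h1, -, h2⟩
  have hrow : ∀ j ∈ fixedIndices p q, star A *ᵥ Pi.single j 1 = Pi.single j 1 := by
    rintro (j | j) hj
    · ext i
      rw [mulVec_single_one, star_eq_conjTranspose, conjTranspose_eq_transpose_of_trivial]
      simpa [Pi.single_apply] using h1 j (hj j rfl) i
    · ext i
      rw [mulVec_single_one, star_eq_conjTranspose, conjTranspose_eq_transpose_of_trivial]
      simpa [Pi.single_apply] using h2 j i
  refine ⟨mem_unitary_of_mem_SOPairSet hA, fun j hj => ?_⟩
  conv_lhs => rw [← hrow j hj]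
  rw [mulVec_mulVec, hA.2.1, one_mulVec]

theorem lrOrbit_mono_right {R : Type*} [Semiring R] [StarRing R] [DecidableEq n]
    {G H H' : Set (Matrix n n R)} (h : H ⊆ H') (k : Matrix n n R) :
    lrOrbit G H k ⊆ lrOrbit G H' k := by
  rintro x ⟨g, hg, b, hb, rfl⟩
  exact ⟨g, hg, b, h hb, rfl⟩

theorem lieSub_fixingGroup_le_blockSkew :
    (isClosedOrthGroup_fixingGroup (fixedIndices p q)).lieSub ≤ blockSkew (Fin p) (Fin q) :=
  fun _ hX => ⟨hX.1, fun i j => (apply_eq_zero_of_mem_lieSub_fixingGroup hX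
    (j := Sum.inr j) (fun _ h => by simp at h) (Sum.inl i)).1⟩

theorem IsClosedOrthGroup.lieSub_le_blockSkew
    {G : Set (Matrix (Fin p ⊕ Fin q) (Fin p ⊕ Fin q) ℝ)} (hG : IsClosedOrthGroup G)
    (hGK : G ⊆ SOPairSet p q) : hG.lieSub ≤ blockSkew (Fin p) (Fin q) := by
  intro X hX
  refine ⟨hX.1, fun i j => ?_⟩
  have h1 := hasDerivAt_matrix_iff.mp (hasDerivAt_exp_smul X 0) (Sum.inl i) (Sum.inr j)
  simp only [zero_smul, NormedSpace.exp_zero, one_mul] at h1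
  refine h1.unique ?_
  have : (fun s : ℝ => NormedSpace.exp (s • X) (Sum.inl i) (Sum.inr j)) = fun _ => 0 :=
    funext fun s => ((hGK (hX.2 s)).2.2.1 i j).1
  rw [this]
  exact hasDerivAt_const _ _

theorem frob_eq_zero_of_mem_lieSub_fixingGroup {X Y : Matrix (Fin p ⊕ Fin q) (Fin p ⊕ Fin q) ℝ}
    (hX : X ∈ (isClosedOrthGroup_fixingGroup (fixedIndices p q)).lieSub)
    (hY : ∀ i j : Fin p, q ≤ (i : ℕ) → q ≤ (j : ℕ) → Y (Sum.inl i) (Sum.inl j) = 0) :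
    frob _ X Y = 0 := by
  rw [frob_eq_sum]
  refine Finset.sum_eq_zero fun x _ => Finset.sum_eq_zero fun y _ => ?_
  by_cases hx : x ∈ fixedIndices p q
  · rw [(apply_eq_zero_of_mem_lieSub_fixingGroup hX hx y).1, zero_mul]
  by_cases hy : y ∈ fixedIndices p q
  · rw [(apply_eq_zero_of_mem_lieSub_fixingGroup hX hy x).2, zero_mul]
  simp only [fixedIndices, Set.mem_ofPred_eq, not_forall, not_lt] at hx hy
  obtain ⟨i, rfl, hi⟩ := hx
  obtain ⟨j, rfl, hj⟩ := hy
  rw [hY j i hj hi, mul_zero]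

end Cohomogeneity

end

theorem statement12 (p q : ℕ) (hq : 5 ≤ q) (hqp : q + 2 ≤ p)
    (G : Set (Matrix (Fin p ⊕ Fin q) (Fin p ⊕ Fin q) ℝ))
    (hGK : G ⊆ SOPairSet p q) (hgrp : IsMatSubgroup G) (hclosed : IsClosed G)
    (hconn : IsConnected G)
    (hcoh : lrCohomogeneity G (SOPrincipalIsotropy p q) (SOPairSet p q) ≤ 1) :
    G = SOPairSet p q := by
  have hG : IsClosedOrthGroup G :=
    ⟨hgrp, fun a ha => mem_unitary_of_mem_SOPairSet (hGK ha), hclosed⟩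
  obtain ⟨k, hk, hfin⟩ := exists_finrank_le_of_lrCohomogeneity_le_one hcoh
  have hku := mem_unitary_of_mem_SOPairSet hk
  have hks : star k * k = 1 := hk.1
  have hks' : k * star k = 1 := hk.2.1
  have hG' := hG.conj hku
  have hH := isClosedOrthGroup_fixingGroup (fixedIndices p q)
  have hG'K : {a | k * a * star k ∈ G} ⊆ SOPairSet p q := by
    intro a ha
    have : star k * (k * a * star k) * k = a := by
      calc _ = (star k * k) * a * (star k * k) := by noncomm_ring
        _ = a := by rw [hks, one_mul, mul_one]
    rw [← this]
    exact mul_mem_SOPairSet (mul_mem_SOPairSet (star_mem_SOPairSet hk) (hGK ha)) hk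
  have hle := hG'.lieSub_le_blockSkew hG'K
  have hdim : finrank ℝ (blockSkew (Fin p) (Fin q)) ≤
      finrank ℝ (hG'.lieSub ⊔ hH.lieSub : Submodule ℝ _) + 1 := by
    refine hfin.trans (Nat.add_le_add_right ?_ 1)
    refine (Submodule.finrank_mono (matTangentAt_mono
      (lrOrbit_mono_right SOPrincipalIsotropy_subset_fixingGroup k) k)).trans ?_
    exact finrank_matTangentAt_lrOrbit_le hku hG' hH
  have heq := eq_blockSkew_of_proportional hq hqp hle (fun A hA B hB => hG'.lie_mem_lieSub hA hB)
    fun Y hY Y' hY' hgY hgY' hW hW' hne => by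
      have hperp : ∀ {Z}, (∀ X ∈ hG'.lieSub, frob _ X Z = 0) →
          (∀ i j : Fin p, q ≤ (i : ℕ) → q ≤ (j : ℕ) → Z (Sum.inl i) (Sum.inl j) = 0) →
          ∀ X ∈ hG'.lieSub ⊔ hH.lieSub, frob _ X Z = 0 := by
        intro Z h1 h2 X hX
        obtain ⟨A, hA, B, hB, rfl⟩ := Submodule.mem_sup.mp hX
        rw [map_add, LinearMap.add_apply, h1 A hA, frob_eq_zero_of_mem_lieSub_fixingGroup hB h2,
          add_zero]
      exact exists_eq_smul_of_finrank_le (sup_le hle lieSub_fixingGroup_le_blockSkew) hdim hY hY'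
        (hperp hgY hW) (hperp hgY' hW') hne
  refine hGK.antisymm fun A hA => ?_
  have hA' : star k * A * k ∈ {a | k * a * star k ∈ G} :=
    SOPairSet_subset_of_blockSkew_le hG' hG'K heq.ge
      (mul_mem_SOPairSet (mul_mem_SOPairSet (star_mem_SOPairSet hk) hA) hk)
  have : k * (star k * A * k) * star k = A := by
    calc _ = (k * star k) * A * (k * star k) := by noncomm_ring
      _ = A := by rw [hks', one_mul, mul_one]
  rwa [Set.mem_ofPred_eq, this] at hA'
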